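/- Let V, W ⊆ S^d be disjoint equivalent polybox codes without twin pairs. If there are i ∈ [d] and l ∈ S such that V = V^{i,l} ∪ V^{i,l'} with both V^{i,l} ≠ ∅ and V^{i,l'} ≠ ∅, then |V| ≥ 24. -/

import Mathlib

/-- Two words `u, v ∈ S^d` are dichotomous if `v j = (u j)'` for some coordinate `j`. -/
def Dichotomous {S : Type*} (c : S → S) {d : ℕ} (u v : Fin d → S) : Prop :=
  ∃ j, v j = c (u j)

/-- Two words form a twin pair if they differ by complementation at exactly one
coordinate and agree elsewhere. -/
def TwinPair {S : Type*} (c : S → S) {d : ℕ} (u v : Fin d → S) : Prop :=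
  ∃ j, v j = c (u j) ∧ ∀ i, i ≠ j → u i = v i

/-- A polybox code: a set of pairwise dichotomous words. -/
def PolyboxCode {S : Type*} (c : S → S) {d : ℕ} (V : Finset (Fin d → S)) : Prop :=
  ∀ u ∈ V, ∀ v ∈ V, u ≠ v → Dichotomous c u v

/-- A code without twin pairs. -/
def TwinPairFree {S : Type*} (c : S → S) {d : ℕ} (V : Finset (Fin d → S)) : Prop :=
  ∀ u ∈ V, ∀ v ∈ V, ¬ TwinPair c u v

/-- `ES`: the collection of all `B ⊆ S` containing exactly one letter from each
complementary pair `{s, s'}`. -/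
def ESet {S : Type*} (c : S → S) : Set (Set S) :=
  {B | ∀ s : S, Xor' (s ∈ B) (c s ∈ B)}

/-- The equicomplementary realization `v̆ = Ev₁ × ⋯ × Ev_d` of a word `v`,
where `Es = {B ∈ ES : s ∈ B}`. -/
def WordBox {S : Type*} (c : S → S) {d : ℕ} (v : Fin d → S) : Set (Fin d → Set S) :=
  {x | ∀ i, x i ∈ ESet c ∧ v i ∈ x i}

/-- `⋃ E(V)`, the union of the equicomplementary realizations of the words of `V`. -/
def CodeReal {S : Type*} (c : S → S) {d : ℕ} (V : Finset (Fin d → S)) :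
    Set (Fin d → Set S) :=
  ⋃ v ∈ V, WordBox c v

/-- The word `w` is covered by the code `V`, i.e. `w̆ ⊆ ⋃ E(V)`. -/
def Covered {S : Type*} (c : S → S) {d : ℕ} (w : Fin d → S)
    (V : Finset (Fin d → S)) : Prop :=
  WordBox c w ⊆ CodeReal c V

/-- Codes `V` and `W` are equivalent: `⋃ E(V) = ⋃ E(W)`. -/
def EquivalentCodes {S : Type*} (c : S → S) {d : ℕ} (V W : Finset (Fin d → S)) : Prop :=
  CodeReal c V = CodeReal c W

set_option linter.unusedSectionVars false
namespace PB
open Finset Classical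

universe u
variable {K : Type u} {d n : ℕ}

abbrev Word (K : Type u) (d : ℕ) := Fin d → K × Bool
abbrev Pt (K : Type u) (d : ℕ) := Fin d → K → Bool

def fl (s : K × Bool) : K × Bool := (s.1, !s.2)
def lit (B : K → Bool) (s : K × Bool) : Prop := B s.1 = s.2
def mem (v : Word K d) (x : Pt K d) : Prop := ∀ i, lit (x i) (v i)
noncomputable def cnt (V : Finset (Word K d)) (x : Pt K d) : ℤ := ∑ v ∈ V, if mem v x then 1 else 0
def Reg (V : Finset (Word K d)) (x : Pt K d) : Prop := ∃ v ∈ V, mem v x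
def Meets (u v : Word K d) : Prop := ∃ x, mem u x ∧ mem v x
noncomputable def flipB (B : K → Bool) (k : K) : K → Bool := Function.update B k (!B k)

structure Good (V : Finset (Word K d)) : Prop where
  code : ∀ u ∈ V, ∀ v ∈ V, ∀ x, mem u x → mem v x → u = v
  tf : ∀ u ∈ V, ∀ v ∈ V, ∀ j, (∀ i, i ≠ j → u i = v i) → v j ≠ fl (u j)

theorem fl_fl (s : K × Bool) : fl (fl s) = s := by simp [fl]
theorem fl_ne (s : K × Bool) : fl s ≠ s := by
  intro h; have := congrArg Prod.snd h; simp [fl] at this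
theorem fl_fst (s : K × Bool) : (fl s).1 = s.1 := rfl
theorem eq_or_fl {a b : K × Bool} (h : a.1 = b.1) : a = b ∨ a = fl b := by
  rcases a with ⟨a, x⟩; rcases b with ⟨b, y⟩
  simp only at h; subst h
  cases x <;> cases y <;> simp [fl]
theorem lit_fl {B : K → Bool} {s : K × Bool} : lit B (fl s) ↔ ¬ lit B s := by
  unfold lit fl; cases h : B s.1 <;> cases h2 : s.2 <;> simp
theorem lit_eq {B : K → Bool} {a b : K × Bool} (ha : lit B a) (hb : lit B b) (h : a.1 = b.1) : a = b := by
  rcases eq_or_fl h with h | h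
  · exact h
  · subst h; exact absurd hb (lit_fl.1 ha)
theorem lit_flip_ne {B : K → Bool} {k : K} {s : K × Bool} (h : s.1 ≠ k) : lit (flipB B k) s ↔ lit B s := by
  unfold lit flipB; rw [Function.update_of_ne h]
theorem lit_flip_eq {B : K → Bool} {k : K} {s : K × Bool} (h : s.1 = k) : lit (flipB B k) s ↔ ¬ lit B s := by
  subst h; unfold lit flipB; rw [Function.update_self]; cases B s.1 <;> cases s.2 <;> simp
theorem two_lit {a b : K × Bool} (h : b ≠ fl a) : ∃ B : K → Bool, lit B a ∧ lit B b := by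
  refine ⟨fun k => if k = a.1 then a.2 else b.2, by simp [lit], ?_⟩
  unfold lit
  by_cases hk : b.1 = a.1
  · rcases eq_or_fl hk with h1 | h1
    · subst h1; simp
    · exact absurd h1 h
  · simp [hk]
theorem meets_of {u v : Word K d} (h : ∀ i, v i ≠ fl (u i)) : Meets u v := by
  choose x hx using fun i => two_lit (h i)
  exact ⟨x, fun i => (hx i).1, fun i => (hx i).2⟩
theorem Meets.ne {u v : Word K d} (h : Meets u v) (i) : v i ≠ fl (u i) := by
  rintro e; obtain ⟨x, h1, h2⟩ := h
  have := h2 i; rw [e] at this; exact lit_fl.1 this (h1 i)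
theorem Meets.symm {u v : Word K d} (h : Meets u v) : Meets v u := by
  obtain ⟨x, h1, h2⟩ := h; exact ⟨x, h2, h1⟩
theorem not_meets {u v : Word K d} (h : ¬ Meets u v) : ∃ j, v j = fl (u j) := by
  by_contra hc; push Not at hc; exact h (meets_of hc)
theorem exists_mem (u : Word K d) : ∃ x, mem u x := by
  obtain ⟨x, h, _⟩ := meets_of (u := u) (v := u) (fun i => (fl_ne _).symm)
  exact ⟨x, h⟩

theorem incl {y w a : Word K d} {x : Pt K d} (hy : mem y x) (hw : mem w x)
    (h : ∀ x, mem y x → mem w x → mem a x) (i) : a i = y i ∨ a i = w i := by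
  by_contra hc
  push Not at hc
  have ha := h x hy hw
  have h1 : (y i).1 ≠ (a i).1 := fun e => hc.1 (lit_eq (hy i) (ha i) e).symm
  have h2 : (w i).1 ≠ (a i).1 := fun e => hc.2 (lit_eq (hw i) (ha i) e).symm
  have key : ∀ z : Word K d, mem z x → (z i).1 ≠ (a i).1 →
      mem z (Function.update x i (flipB (x i) (a i).1)) := by
    intro z hz hne k
    by_cases hk : k = i
    · subst hk; rw [Function.update_self, lit_flip_ne hne]; exact hz _
    · rw [Function.update_of_ne hk]; exact hz k
  have := h _ (key y hy h1) (key w hw h2) i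
  rw [Function.update_self, lit_flip_eq rfl] at this
  exact this (ha i)

/-! slices -/
def ins {α : Type*} (i : Fin (n+1)) (s : α) (u : Fin n → α) : Fin (n+1) → α :=
  Fin.insertNth (α := fun _ => α) i s u
def rem {α : Type*} (i : Fin (n+1)) (v : Fin (n+1) → α) : Fin n → α := fun j => v (i.succAbove j)
theorem ins_same {α : Type*} (i : Fin (n+1)) (s : α) (u : Fin n → α) : ins i s u i = s := by
  simp [ins]
theorem ins_succ {α : Type*} (i : Fin (n+1)) (s : α) (u : Fin n → α) (j) : ins i s u (i.succAbove j) = u j := by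
  simp [ins]
theorem rem_ins {α : Type*} (i : Fin (n+1)) (s : α) (u : Fin n → α) : rem i (ins i s u) = u := by
  funext j; exact ins_succ i s u j
theorem ins_rem {α : Type*} (i : Fin (n+1)) (v : Fin (n+1) → α) : ins i (v i) (rem i v) = v := by
  funext k
  rcases Fin.eq_self_or_eq_succAbove i k with rfl | ⟨j, rfl⟩
  · rw [ins_same]
  · rw [ins_succ]; rfl
theorem ins_inj {α : Type*} {i : Fin (n+1)} {s t : α} {u v : Fin n → α} (h : ins i s u = ins i t v) : s = t ∧ u = v := by
  constructor
  · have := congrFun h i; simpa [ins_same] using this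
  · have := congrArg (rem i) h; simpa [rem_ins] using this
theorem mem_ins {i : Fin (n+1)} {s : K × Bool} {u : Word K n} {B : K → Bool} {y : Pt K n} :
    mem (ins i s u) (ins i B y) ↔ lit B s ∧ mem u y := by
  unfold mem
  rw [Fin.forall_iff_succAbove i]
  simp only [ins_same, ins_succ]
theorem mem_iff_rem {i : Fin (n+1)} {v : Word K (n+1)} {B : K → Bool} {y : Pt K n} :
    mem v (ins i B y) ↔ lit B (v i) ∧ mem (rem i v) y := by
  conv_lhs => rw [← ins_rem i v]
  exact mem_ins

variable [Fintype K]

noncomputable def slV (i : Fin (n+1)) (s : K × Bool) (V : Finset (Word K (n+1))) : Finset (Word K n) :=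
  univ.filter (fun u => ins i s u ∈ V)
theorem mem_slV {i : Fin (n+1)} {s : K × Bool} {V : Finset (Word K (n+1))} {u : Word K n} :
    u ∈ slV i s V ↔ ins i s u ∈ V := by simp [slV]
theorem rem_mem_slV {i : Fin (n+1)} {V : Finset (Word K (n+1))} {v : Word K (n+1)} (h : v ∈ V) :
    rem i v ∈ slV i (v i) V := by rw [mem_slV, ins_rem]; exact h
theorem Reg_ins {i : Fin (n+1)} {V : Finset (Word K (n+1))} {B : K → Bool} {y : Pt K n} :
    Reg V (ins i B y) ↔ ∃ s, lit B s ∧ Reg (slV i s V) y := by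
  constructor
  · rintro ⟨v, hv, hm⟩
    rw [mem_iff_rem] at hm
    exact ⟨v i, hm.1, rem i v, rem_mem_slV hv, hm.2⟩
  · rintro ⟨s, hs, u, hu, hm⟩
    exact ⟨ins i s u, mem_slV.1 hu, mem_ins.2 ⟨hs, hm⟩⟩
theorem Good.sl {V : Finset (Word K (n+1))} (h : Good V) (i s) : Good (slV i s V) := by
  constructor
  · intro u hu v hv x h1 h2
    have := h.code _ (mem_slV.1 hu) _ (mem_slV.1 hv) (ins i (fun _ => s.2) x) (mem_ins.2 ⟨rfl, h1⟩) (mem_ins.2 ⟨rfl, h2⟩)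
    exact (ins_inj this).2
  · intro u hu v hv j h1
    have := h.tf _ (mem_slV.1 hu) _ (mem_slV.1 hv) (i.succAbove j) (by
      intro k hk
      rcases Fin.eq_self_or_eq_succAbove i k with rfl | ⟨m, rfl⟩
      · simp [ins_same]
      · simp only [ins_succ]; apply h1; rintro rfl; exact hk rfl)
    simpa [ins_succ] using this
theorem Good.mono {V U : Finset (Word K d)} (h : Good V) (hs : U ⊆ V) : Good U :=
  ⟨fun u hu v hv => h.code u (hs hu) v (hs hv), fun u hu v hv => h.tf u (hs hu) v (hs hv)⟩
/-- same word in complementary slices is a twin pair -/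
theorem Good.sl_tw {V : Finset (Word K (n+1))} (h : Good V) {i s u} (h1 : u ∈ slV i s V) (h2 : u ∈ slV i (fl s) V) : False := by
  refine h.tf _ (mem_slV.1 h1) _ (mem_slV.1 h2) i ?_ (by simp [ins_same])
  intro k hk
  rcases Fin.eq_self_or_eq_succAbove i k with rfl | ⟨m, rfl⟩
  · exact absurd rfl hk
  · simp [ins_succ]
/-- words in slices with compatible distinct letters have disjoint boxes -/
theorem Good.sl_sep {V : Finset (Word K (n+1))} (h : Good V) {i s t u v x} (hst : t ≠ fl s) (hne : s ≠ t)
    (h1 : u ∈ slV i s V) (h2 : v ∈ slV i t V) (hu : mem u x) (hv : mem v x) : False := by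
  obtain ⟨B, hs, ht⟩ := two_lit hst
  exact hne (ins_inj (h.code _ (mem_slV.1 h1) _ (mem_slV.1 h2) (ins i B x) (mem_ins.2 ⟨hs, hu⟩) (mem_ins.2 ⟨ht, hv⟩))).1

theorem card_sl (i : Fin (n+1)) (V : Finset (Word K (n+1))) : V.card = ∑ s, (slV i s V).card := by
  rw [Finset.card_eq_sum_card_fiberwise (f := fun v => v i) (t := univ) (by intro _ _; simp)]
  refine Finset.sum_congr rfl (fun s _ => ?_)
  refine Finset.card_bij (fun v _ => rem i v) ?_ ?_ ?_
  · intro v hv; simp only [mem_filter] at hv; rw [← hv.2]; exact rem_mem_slV hv.1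
  · intro v hv w hw e
    simp only [mem_filter] at hv hw
    rw [← ins_rem i v, ← ins_rem i w, hv.2, hw.2, e]
  · intro u hu
    exact ⟨ins i s u, by simp [ins_same, mem_slV.1 hu], rem_ins _ _ _⟩
theorem card_sl2 (i : Fin (n+1)) (V : Finset (Word K (n+1))) {a b : K × Bool} (h : a ≠ b) :
    (slV i a V).card + (slV i b V).card ≤ V.card := by
  rw [card_sl i V, ← Finset.sum_pair h (f := fun s => (slV i s V).card)]
  exact Finset.sum_le_sum_of_subset (subset_univ _)
theorem card_sl3 (i : Fin (n+1)) (V : Finset (Word K (n+1))) {a b c : K × Bool} (h : a ≠ b) (h1 : a ≠ c) (h2 : b ≠ c) :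
    (slV i a V).card + (slV i b V).card + (slV i c V).card ≤ V.card := by
  rw [card_sl i V]
  calc _ = ∑ s ∈ ({a, b, c} : Finset (K × Bool)), (slV i s V).card := by
        rw [Finset.sum_insert (by simp [h, h1]), Finset.sum_pair h2, add_assoc]
    _ ≤ _ := Finset.sum_le_sum_of_subset (subset_univ _)

/-! cnt -/
theorem cnt_good {V : Finset (Word K d)} (h : Good V) (x) : cnt V x = if Reg V x then 1 else 0 := by
  unfold cnt
  split_ifs with hr
  · obtain ⟨v, hv, hm⟩ := hr
    rw [Finset.sum_eq_single v]
    · simp [hm]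
    · intro u hu hne
      rw [if_neg]; intro hmu; exact hne (h.code u hu v hv x hmu hm)
    · intro hn; exact absurd hv hn
  · apply Finset.sum_eq_zero
    intro v hv; rw [if_neg]; intro hm; exact hr ⟨v, hv, hm⟩
theorem cnt_nonneg (V : Finset (Word K d)) (x) : 0 ≤ cnt V x :=
  Finset.sum_nonneg (fun _ _ => by split_ifs <;> simp)
theorem cnt_pos {V : Finset (Word K d)} {x} : 0 < cnt V x ↔ Reg V x := by
  unfold cnt Reg
  constructor
  · intro h
    by_contra hc
    push Not at hc
    rw [Finset.sum_eq_zero] at h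
    · simp at h
    · intro v hv; simp [hc v hv]
  · rintro ⟨v, hv, hm⟩
    refine Finset.sum_pos' (fun _ _ => by split_ifs <;> simp) ⟨v, hv, by simp [hm]⟩
theorem cnt_zero {V : Finset (Word K d)} {x} : cnt V x = 0 ↔ ¬ Reg V x := by
  rw [← cnt_pos]; have := cnt_nonneg V x; omega
theorem cnt_ins (i : Fin (n+1)) (V : Finset (Word K (n+1))) (B : K → Bool) (y : Pt K n) :
    cnt V (ins i B y) = ∑ s, if lit B s then cnt (slV i s V) y else 0 := by
  unfold cnt
  rw [← Finset.sum_fiberwise (s := V) (g := fun v => v i)]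
  refine Finset.sum_congr rfl (fun s _ => ?_)
  have : ∀ v ∈ V.filter (fun v => v i = s), (if mem v (ins i B y) then (1:ℤ) else 0) = if lit B s then (if mem (rem i v) y then 1 else 0) else 0 := by
    intro v hv
    simp only [mem_filter] at hv
    simp only [mem_iff_rem, hv.2]
    by_cases h1 : lit B s <;> simp [h1]
  rw [Finset.sum_congr rfl this]
  split_ifs with hs
  · refine Finset.sum_bij (fun v _ => rem i v) ?_ ?_ ?_ ?_
    · intro v hv; simp only [mem_filter] at hv; rw [← hv.2]; exact rem_mem_slV hv.1
    · intro v hv w hw e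
      simp only [mem_filter] at hv hw
      rw [← ins_rem i v, ← ins_rem i w, hv.2, hw.2, e]
    · intro u hu
      exact ⟨ins i s u, by simp [ins_same, mem_slV.1 hu], rem_ins _ _ _⟩
    · intro _ _; rfl
  · simp
/-- flip identity -/
theorem cnt_flip (i : Fin (n+1)) (V : Finset (Word K (n+1))) {B : K → Bool} {l : K × Bool} (hl : lit B l) (y : Pt K n) :
    cnt V (ins i B y) - cnt V (ins i (flipB B l.1) y) = cnt (slV i l V) y - cnt (slV i (fl l) V) y := by
  rw [cnt_ins, cnt_ins, ← Finset.sum_sub_distrib]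
  rw [Finset.sum_eq_add l (fl l) (fl_ne l).symm]
  · have h1 : ¬ lit (flipB B l.1) l := by rw [lit_flip_eq rfl]; simpa using hl
    have h2 : lit (flipB B l.1) (fl l) := by rw [lit_flip_eq (fl_fst l), lit_fl]; simpa using hl
    have h3 : ¬ lit B (fl l) := by rw [lit_fl]; simpa using hl
    simp [hl, h1, h2, h3]; ring
  · intro s _ hs
    have : s.1 ≠ l.1 := by
      intro e; rcases eq_or_fl e with e | e
      · exact hs.1 e
      · exact hs.2 e
    simp [lit_flip_ne this]
  · simp
  · simp
/-- two letters sum identity -/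
theorem cnt_two (i : Fin (n+1)) (V : Finset (Word K (n+1))) {B : K → Bool} {a b : K × Bool} (ha : lit B a) (hb : lit B b)
    (hab : a ≠ b) (hV : ∀ v ∈ V, lit B (v i) → v i = a ∨ v i = b) (y : Pt K n) :
    cnt V (ins i B y) = cnt (slV i a V) y + cnt (slV i b V) y := by
  rw [cnt_ins, Finset.sum_eq_add a b hab]
  · simp [ha, hb]
  · intro s _ hs
    split_ifs with h
    · rw [cnt_zero]
      rintro ⟨u, hu, _⟩
      have h1 := hV _ (mem_slV.1 hu)
      rw [ins_same] at h1
      rcases h1 h with h | h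
      · exact hs.1 h
      · exact hs.2 h
    · rfl
  · simp
  · simp

/-! volume -/
theorem half (p : K) (b : Bool) : 2 * (univ.filter (fun g : K → Bool => g p = b)).card = Fintype.card (K → Bool) := by
  have h1 : (univ.filter (fun g : K → Bool => g p = b)).card = (univ.filter (fun g : K → Bool => ¬ g p = b)).card := by
    refine Finset.card_bij (fun g _ => flipB g p) ?_ ?_ ?_
    · intro g hg; simp at hg; subst hg; simp [flipB]
    · intro g _ g' _ e
      have e' : flipB g p = flipB g' p := e
      funext k
      have := congrFun e' k
      by_cases hk : k = p
      · subst hk; simpa [flipB] using this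
      · simpa [flipB, hk] using this
    · intro g hg
      refine ⟨flipB g p, ?_, ?_⟩
      · have hg' := (mem_filter.1 hg).2
        refine mem_filter.2 ⟨mem_univ _, ?_⟩
        have e : flipB g p p = !g p := by simp [flipB]
        rw [e]; revert hg'; cases g p <;> cases b <;> simp
      · simp [flipB]
  have := Finset.card_filter_add_card_filter_not (s := (univ : Finset (K → Bool))) (fun g : K → Bool => g p = b)
  rw [Finset.card_univ] at this
  omega
theorem vol_word (u v : Word K d) : (univ.filter (fun x : Pt K d => mem u x)).card = (univ.filter (fun x : Pt K d => mem v x)).card := by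
  have : ∀ u : Word K d, univ.filter (fun x : Pt K d => mem u x) = Fintype.piFinset (fun i => univ.filter (fun g : K → Bool => g (u i).1 = (u i).2)) := by
    intro u; ext x; simp only [mem_filter, mem_univ, true_and, Fintype.mem_piFinset]; exact Iff.rfl
  rw [this, this, Fintype.card_piFinset, Fintype.card_piFinset]
  refine Finset.prod_congr rfl (fun i _ => ?_)
  have h1 := half (u i).1 (u i).2
  have h2 := half (v i).1 (v i).2
  omega
theorem vol : ∃ N : ℤ, 0 < N ∧ ∀ V : Finset (Word K d), ∑ x, cnt V x = N * V.card := by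
  by_cases hne : Nonempty (Word K d)
  · obtain ⟨u⟩ := hne
    refine ⟨(univ.filter (fun x : Pt K d => mem u x)).card, ?_, ?_⟩
    · obtain ⟨x, hx⟩ := exists_mem u
      exact_mod_cast Finset.card_pos.2 ⟨x, by simp [hx]⟩
    · intro V
      unfold cnt
      rw [Finset.sum_comm]
      rw [Finset.sum_congr rfl (g := fun _ => ((univ.filter (fun x : Pt K d => mem u x)).card : ℤ))]
      · simp [mul_comm]
      · intro v _
        rw [Finset.sum_boole, vol_word v u]
  · refine ⟨1, one_pos, fun V => ?_⟩
    have : V = ∅ := by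
      rw [Finset.eq_empty_iff_forall_notMem]; intro v _; exact hne ⟨v⟩
    subst this; simp [cnt]
theorem card_eq_of_cnt {A B C D E F : Finset (Word K d)} (h : ∀ x, cnt A x + cnt B x + cnt C x = cnt D x + cnt E x + cnt F x) :
    A.card + B.card + C.card = D.card + E.card + F.card := by
  obtain ⟨N, hN, hv⟩ := vol (K := K) (d := d)
  have := Finset.sum_congr rfl (fun x (_ : x ∈ (univ : Finset (Pt K d))) => h x)
  simp only [Finset.sum_add_distrib, hv] at this
  have h2 : N * ((A.card + B.card + C.card : ℕ) : ℤ) = N * ((D.card + E.card + F.card : ℕ) : ℤ) := by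
    push_cast; linarith
  exact_mod_cast mul_left_cancel₀ hN.ne' h2
theorem cnt_empty (x : Pt K d) : cnt (∅ : Finset (Word K d)) x = 0 := by simp [cnt]
theorem cnt_single (u : Word K d) (x : Pt K d) : cnt {u} x = if mem u x then 1 else 0 := by unfold cnt; rw [Finset.sum_singleton]
theorem card_eq2 {A B C D : Finset (Word K d)} (h : ∀ x, cnt A x + cnt B x = cnt C x + cnt D x) :
    A.card + B.card = C.card + D.card := by
  have := card_eq_of_cnt (A := A) (B := B) (C := ∅) (D := C) (E := D) (F := ∅) (by intro x; simp [cnt_empty, h])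
  simpa using this
theorem card_eq1 {A B : Finset (Word K d)} (h : ∀ x, cnt A x = cnt B x) : A.card = B.card := by
  have := card_eq2 (A := A) (B := ∅) (C := B) (D := ∅) (by intro x; simp [cnt_empty, h])
  simpa using this
end PB
namespace PB
open Finset Classical
universe u
variable {K : Type u} {d n : ℕ} [Fintype K]

theorem reg_of_cnt {A B : Finset (Word K d)} {x : Pt K d} (h : cnt A x = cnt B x) : Reg A x ↔ Reg B x := by
  rw [← cnt_pos, ← cnt_pos, h]
theorem flip_reg {i : Fin (n+1)} {V : Finset (Word K (n+1))} {B : K → Bool} {l : K × Bool} (hl : lit B l) {y : Pt K n}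
    (h : cnt V (ins i B y) = cnt V (ins i (flipB B l.1) y)) : Reg (slV i l V) y ↔ Reg (slV i (fl l) V) y := by
  apply reg_of_cnt
  have := cnt_flip i V hl y
  omega

noncomputable def ft (Y : Finset (Word K d)) (w : Word K d) : Finset (Word K d) := Y.filter (fun y => Meets y w)
theorem mem_ft {Y : Finset (Word K d)} {w y : Word K d} : y ∈ ft Y w ↔ y ∈ Y ∧ Meets y w := by simp [ft]
theorem ft_sub (Y : Finset (Word K d)) (w : Word K d) : ft Y w ⊆ Y := Finset.filter_subset _ _
theorem ft_card (Y : Finset (Word K d)) (w : Word K d) : (ft Y w).card ≤ Y.card := Finset.card_le_card (ft_sub Y w)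
theorem Reg_ft {Y : Finset (Word K d)} {w : Word K d} {p} (hp : mem w p) : Reg (ft Y w) p ↔ Reg Y p := by
  constructor
  · rintro ⟨v, hv, hm⟩; exact ⟨v, ft_sub _ _ hv, hm⟩
  · rintro ⟨v, hv, hm⟩; exact ⟨v, mem_ft.2 ⟨hv, p, hm, hp⟩, hm⟩
theorem Reg_single {x : Word K d} {p} : Reg {x} p ↔ mem x p := by simp [Reg]

theorem lemC_of (hc : ∀ (Y : Finset (Word K d)) (x), Good Y → x ∉ Y → (∀ p, mem x p → Reg Y p) → 5 ≤ Y.card)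
    {Y : Finset (Word K d)} {x w : Word K d} (hY : Good Y) (hx : x ∉ Y) (hm : Meets x w)
    (h : ∀ p, mem w p → (Reg Y p ↔ mem x p)) : 5 ≤ (ft Y w).card := by
  apply hc _ x (hY.mono (ft_sub _ _)) (fun h => hx (mem_ft.1 h).1)
  intro p hp
  have : ∀ i, ∃ B, lit B (x i) ∧ lit B (w i) ∧ (x i = w i → B = p i) := by
    intro i
    by_cases e : x i = w i
    · exact ⟨p i, hp i, e ▸ hp i, fun _ => rfl⟩
    · obtain ⟨B, h1, h2⟩ := two_lit (hm.ne i)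
      exact ⟨B, h1, h2, fun h => absurd h e⟩
  choose q hq1 hq2 hq3 using this
  obtain ⟨y, hy, hyq⟩ := (h q hq2).2 hq1
  refine ⟨y, mem_ft.2 ⟨hy, q, hyq, hq2⟩, ?_⟩
  have hi := incl hyq hq2 (fun r h1 h2 => (h r h2).1 ⟨y, hy, h1⟩)
  intro i
  by_cases e : x i = w i
  · rw [← hq3 i e]; exact hyq i
  · rcases hi i with h1 | h1
    · rw [← h1]; exact hp i
    · exact absurd h1 e

theorem cover5 (Y : Finset (Word K d)) (x) (hY : Good Y) (hx : x ∉ Y) (h : ∀ p, mem x p → Reg Y p) : 5 ≤ Y.card := by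
  induction d with
  | zero =>
    obtain ⟨p, hp⟩ := exists_mem x
    obtain ⟨y, hy, _⟩ := h p hp
    rw [Subsingleton.elim y x] at hy; exact absurd hy hx
  | succ n ih =>
    suffices hs : 5 ≤ (ft Y x).card from hs.trans (ft_card _ _)
    have hZ := hY.mono (ft_sub Y x)
    have hxZ : x ∉ ft Y x := fun h => hx (ft_sub _ _ h)
    have hZm : ∀ y ∈ ft Y x, Meets y x := fun y hy => (mem_ft.1 hy).2
    have hZc : ∀ p, mem x p → Reg (ft Y x) p := fun p hp => (Reg_ft hp).2 (h p hp)
    generalize ft Y x = Z at *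
    obtain ⟨p, hp⟩ := exists_mem x
    obtain ⟨y, hy, hyp⟩ := hZc p hp
    have hne : ∃ i, y i ≠ x i := by
      by_contra hc; push Not at hc; exact hxZ ((funext hc : y = x) ▸ hy)
    obtain ⟨i, hi⟩ := hne
    have ha1 : (y i).1 ≠ (x i).1 := by
      intro e; rcases eq_or_fl e with e | e
      · exact hi e
      · exact (hZm y hy).symm.ne i e
    have hya := rem_mem_slV (i := i) hy
    generalize y i = a at *
    have hfa : (fl a).1 ≠ (x i).1 := ha1
    have hreg : ∀ q, mem (rem i x) q → (Reg (slV i a Z) q ↔ Reg (slV i (fl a) Z) q) := by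
      intro q hq
      have hxa : x i ≠ fl a := by rintro e; rw [e] at ha1; exact ha1 rfl
      obtain ⟨B, hB1, hB2⟩ := two_lit hxa
      apply flip_reg hB1
      rw [cnt_good hZ, cnt_good hZ, if_pos, if_pos]
      · apply hZc; rw [mem_iff_rem]; exact ⟨(lit_flip_ne ha1.symm).2 hB2, hq⟩
      · apply hZc; rw [mem_iff_rem]; exact ⟨hB2, hq⟩
    have hmt : ∀ s, ∀ u ∈ slV i s Z, Meets u (rem i x) := by
      intro s u hu
      obtain ⟨q, h1, h2⟩ := hZm _ (mem_slV.1 hu)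
      rw [← ins_rem i q, mem_iff_rem] at h1 h2
      rw [rem_ins] at h1
      exact ⟨_, h1.2, h2.2⟩
    have hne1 : (slV i a Z).Nonempty := ⟨_, hya⟩
    have hne2 : (slV i (fl a) Z).Nonempty := by
      obtain ⟨q, h1, h2⟩ := hmt _ _ hya
      obtain ⟨v, hv, _⟩ := (hreg q h2).1 ⟨_, hya, h1⟩
      exact ⟨v, hv⟩
    by_contra hcon
    have hsum := card_sl2 i Z (fl_ne a).symm
    have key : ∀ b, (∀ q, mem (rem i x) q → (Reg (slV i b Z) q ↔ Reg (slV i (fl b) Z) q)) → (slV i b Z).card = 1 → 5 ≤ (slV i (fl b) Z).card := by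
      intro b hb h1
      obtain ⟨u, hu⟩ := Finset.card_eq_one.1 h1
      have huu : u ∈ slV i b Z := by rw [hu]; simp
      have := lemC_of ih (hZ.sl i (fl b)) (x := u) (w := rem i x) (fun h => hZ.sl_tw huu h) (hmt _ _ huu) (fun q hq => by
        rw [← hb q hq, hu, Reg_single])
      exact this.trans (ft_card _ _)
    have k1 := key a hreg
    have k2 := key (fl a) (by intro q hq; rw [fl_fl]; exact (hreg q hq).symm)
    rw [fl_fl] at k2
    have c1 := Finset.card_pos.2 hne1
    have c2 := Finset.card_pos.2 hne2
    have hcase : (slV i a Z).card = 2 ∧ (slV i (fl a) Z).card = 2 ∧ Z.card = 4 := by omega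
    obtain ⟨e1, e2, e3⟩ := hcase
    have honly : ∀ s, s ≠ a → s ≠ fl a → slV i s Z = ∅ := by
      intro s h1 h2
      have := card_sl3 i Z (fl_ne a).symm h1.symm h2.symm
      rw [← Finset.card_eq_zero]; omega
    have hcov : ∀ q, mem (rem i x) q → Reg (slV i a Z) q := by
      intro q hq
      obtain ⟨B, hB1, hB2⟩ := two_lit (a := a) (b := x i) (by rintro e; rw [e] at ha1; exact ha1 rfl)
      have := hZc (ins i B q) (by rw [mem_iff_rem]; exact ⟨hB2, hq⟩)
      rw [Reg_ins] at this
      obtain ⟨s, hs, u, hu, hm⟩ := this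
      by_cases h1 : s = a
      · exact ⟨u, h1 ▸ hu, hm⟩
      by_cases h2 : s = fl a
      · exact (hreg q hq).2 ⟨u, h2 ▸ hu, hm⟩
      · rw [honly s h1 h2] at hu; simp at hu
    have := ih (slV i a Z) (rem i x) (hZ.sl _ _) (by
      intro hr
      have : slV i a Z = {rem i x} := by
        apply Finset.eq_singleton_iff_unique_mem.2 ⟨hr, ?_⟩
        intro u hu
        obtain ⟨q, h1, h2⟩ := hmt _ _ hu
        exact (hZ.sl i a).code _ hu _ hr q h1 h2
      rw [this] at e1; simp at e1) hcov
    omega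

theorem cover_mem {Y : Finset (Word K d)} {x} (hY : Good Y) (h : ∀ p, mem x p → Reg Y p) (hc : Y.card ≤ 4) : x ∈ Y := by
  by_contra hx; have := cover5 Y x hY hx h; omega
theorem lemC {Y : Finset (Word K d)} {x w : Word K d} (hY : Good Y) (hx : x ∉ Y) (hm : Meets x w)
    (h : ∀ p, mem w p → (Reg Y p ↔ mem x p)) : 5 ≤ (ft Y w).card := lemC_of cover5 hY hx hm h

theorem lemD1 {A A' : Finset (Word K d)} {w : Word K d} (hA' : Good A') (hd : Disjoint A A')
    (h : ∀ p, mem w p → (Reg A p ↔ Reg A' p)) (h1 : (ft A w).card = 1) : 5 ≤ (ft A' w).card := by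
  obtain ⟨u, hu⟩ := Finset.card_eq_one.1 h1
  have huu : u ∈ ft A w := by rw [hu]; simp
  have hu' := mem_ft.1 huu
  refine lemC hA' (x := u) (Finset.disjoint_left.1 hd hu'.1) hu'.2 ?_
  intro p hp
  rw [← h p hp, ← Reg_ft hp, hu, Reg_single]
theorem ft_pos {A : Finset (Word K d)} {w : Word K d} {p} (hp : mem w p) (h : Reg A p) : 0 < (ft A w).card := by
  obtain ⟨v, hv, hm⟩ := h
  exact Finset.card_pos.2 ⟨v, mem_ft.2 ⟨hv, p, hm, hp⟩⟩
theorem lemD {A A' : Finset (Word K d)} {w : Word K d} (hA : Good A) (hA' : Good A') (hd : Disjoint A A')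
    (h : ∀ p, mem w p → (Reg A p ↔ Reg A' p)) (hne : ∃ p, mem w p ∧ Reg A p) :
    ((ft A w).card = 1 ∧ 5 ≤ (ft A' w).card) ∨ (5 ≤ (ft A w).card ∧ (ft A' w).card = 1) ∨
    (2 ≤ (ft A w).card ∧ 2 ≤ (ft A' w).card) := by
  obtain ⟨p, hp, hr⟩ := hne
  have c1 := ft_pos hp hr
  have c2 := ft_pos hp ((h p hp).1 hr)
  have d1 := lemD1 hA' hd h
  have d2 := lemD1 hA hd.symm (fun p hp => (h p hp).symm)
  omega
end PB
namespace PB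
open Finset Classical
universe u
variable {K : Type u} {d n : ℕ} [Fintype K]

theorem ne_fst {a b : K × Bool} (h1 : a ≠ b) (h2 : a ≠ fl b) : a.1 ≠ b.1 := fun e =>
  (eq_or_fl e).elim h1 h2
theorem ne_of_fst {a b : K × Bool} (h : a.1 ≠ b.1) : a ≠ b := fun e => h (congrArg _ e)
theorem ne_fl_of_fst {a b : K × Bool} (h : a.1 ≠ b.1) : a ≠ fl b := fun e => h (by rw [e]; rfl)
theorem meets_rem {i : Fin (n+1)} {u v : Word K (n+1)} (h : Meets u v) : Meets (rem i u) (rem i v) := by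
  obtain ⟨q, h1, h2⟩ := h
  rw [← ins_rem i q, mem_iff_rem] at h1 h2
  exact ⟨_, h1.2, h2.2⟩

structure Loc (A A' : Finset (Word K (n+1))) (x y : Word K (n+1)) (j : Fin (n+1)) (w : Word K (n+1)) : Prop where
  gA : Good A
  gA' : Good A'
  dis : Disjoint A A'
  hA : A = {x, y}
  hj : y j = fl (x j)
  c3 : A'.card ≤ 3
  eq : ∀ p, mem w p → (Reg A p ↔ Reg A' p)
  mt : ∃ p, mem w p ∧ Reg A p

namespace Loc
variable {A A' : Finset (Word K (n+1))} {x y w w1 w2 z u : Word K (n+1)} {j : Fin (n+1)}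

theorem swap (h : Loc A A' x y j w) : Loc A A' y x j w :=
  ⟨h.gA, h.gA', h.dis, by rw [h.hA, Finset.pair_comm], by rw [h.hj, fl_fl], h.c3, h.eq, h.mt⟩
theorem xne (h : Loc A A' x y j w) : x ≠ y := by
  rintro rfl; exact fl_ne _ h.hj.symm
theorem cA (h : Loc A A' x y j w) : A.card = 2 := by rw [h.hA, Finset.card_pair h.xne]
theorem xA (h : Loc A A' x y j w) : x ∈ A := by rw [h.hA]; simp
theorem ftA' (h : Loc A A' x y j w) : 2 ≤ (ft A' w).card := by
  have := lemD h.gA h.gA' h.dis h.eq h.mt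
  have h1 := ft_card A w
  have h2 := ft_card A' w
  rw [h.cA] at h1; have := h.c3; omega
theorem f1 (h : Loc A A' x y j w) : Meets x w := by
  have := lemD h.gA h.gA' h.dis h.eq h.mt
  have h1 := ft_card A w
  have h2 := ft_card A' w
  rw [h.cA] at h1; have h3 := h.c3
  have h4 : ft A w = A := Finset.eq_of_subset_of_card_le (ft_sub _ _) (by rw [h.cA]; omega)
  have := h.xA; rw [← h4] at this; exact (mem_ft.1 this).2
theorem wj (h : Loc A A' x y j w) : (w j).1 ≠ (x j).1 := by
  apply ne_fst
  · intro e; apply h.swap.f1.ne j; rw [h.hj, fl_fl, e]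
  · intro e; exact h.f1.ne j e
theorem letters (h : Loc A A' x y j w) {z} (hz : z ∈ A') (hm : Meets z w) : z j = x j ∨ z j = fl (x j) ∨ z j = w j := by
  by_contra hc
  push Not at hc
  have e1 : (z j).1 ≠ (x j).1 := ne_fst hc.1 hc.2.1
  have e2 : (z j).1 ≠ (w j).1 := ne_fst hc.2.2 (hm.symm.ne j)
  have hreg : ∀ q, mem (rem j w) q → (Reg (slV j (z j) A') q ↔ Reg (slV j (fl (z j)) A') q) := by
    intro q hq
    obtain ⟨B, hB1, hB2⟩ := two_lit (a := z j) (b := w j) (ne_fl_of_fst e2.symm)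
    apply flip_reg hB1
    have k1 : mem w (ins j B q) := mem_iff_rem.2 ⟨hB2, hq⟩
    have k2 : mem w (ins j (flipB B (z j).1) q) := mem_iff_rem.2 ⟨(lit_flip_ne e2.symm).2 hB2, hq⟩
    rw [cnt_good h.gA', cnt_good h.gA']
    have : Reg A (ins j B q) ↔ Reg A (ins j (flipB B (z j).1) q) := by
      rw [h.hA]; simp only [Reg, mem_insert, mem_singleton, exists_eq_or_imp, exists_eq_left, mem_iff_rem, h.hj]
      rw [lit_flip_ne e1.symm, lit_flip_ne (s := fl (x j)) (by exact e1.symm)]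
    rw [h.eq _ k1, h.eq _ k2] at this
    simp only [this]
  have hm' := meets_rem (i := j) hm
  have := lemD (h.gA'.sl j _) (h.gA'.sl j _) (Finset.disjoint_left.2 fun v h1 h2 => h.gA'.sl_tw h1 h2) hreg
    (by obtain ⟨q, h1, h2⟩ := hm'; exact ⟨q, h2, _, rem_mem_slV hz, h1⟩)
  have h1 := ft_card (slV j (z j) A') (rem j w)
  have h2 := ft_card (slV j (fl (z j)) A') (rem j w)
  have h3 := card_sl2 j A' (fl_ne (z j)).symm
  have := h.c3
  omega
theorem l3 (h : Loc A A' x y j w) {q} (hq : mem (rem j w) q) :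
    mem (rem j x) q ↔ (Reg (slV j (x j) A') q ∨ Reg (slV j (w j) A') q) := by
  obtain ⟨B, hB1, hB2⟩ := two_lit (a := x j) (b := w j) (ne_fl_of_fst h.wj)
  have k1 : mem w (ins j B q) := mem_iff_rem.2 ⟨hB2, hq⟩
  have := h.eq _ k1
  rw [Reg_ins (V := A')] at this
  have e1 : Reg A (ins j B q) ↔ mem (rem j x) q := by
    rw [h.hA]; simp only [Reg, mem_insert, mem_singleton, exists_eq_or_imp, exists_eq_left, mem_iff_rem, h.hj]
    rw [lit_fl]; simp [hB1]
  rw [← e1, this]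
  constructor
  · rintro ⟨s, hs, v, hv, hm⟩
    have hv' := mem_slV.1 hv
    have := h.letters hv' ⟨ins j B q, mem_ins.2 ⟨hs, hm⟩, k1⟩
    rw [ins_same] at this
    rcases this with e | e | e
    · left; rw [← e]; exact ⟨v, hv, hm⟩
    · rw [e, lit_fl] at hs; exact absurd hB1 hs
    · right; rw [← e]; exact ⟨v, hv, hm⟩
  · rintro (hr | hr)
    · exact ⟨_, hB1, hr⟩
    · exact ⟨_, hB2, hr⟩
theorem xnot (h : Loc A A' x y j w) : rem j x ∉ slV j (x j) A' := by
  intro hm; rw [mem_slV, ins_rem] at hm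
  exact Finset.disjoint_left.1 h.dis h.xA hm
theorem l4 (h : Loc A A' x y j w) : ∃ z ∈ A', Meets z w ∧ z j = w j := by
  by_contra hc
  push Not at hc
  have hr : ∀ q, mem (rem j w) q → ¬ Reg (slV j (w j) A') q := by
    rintro q hq ⟨v, hv, hm⟩
    refine hc _ (mem_slV.1 hv) ?_ (ins_same _ _ _)
    obtain ⟨B, hB, _⟩ := two_lit (fl_ne (w j)).symm
    exact ⟨ins j B q, mem_ins.2 ⟨hB, hm⟩, mem_iff_rem.2 ⟨hB, hq⟩⟩
  have := lemC (h.gA'.sl j _) h.xnot (meets_rem h.f1) (fun q hq => by rw [h.l3 hq]; simp [hr q hq])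
  have h1 := ft_card (slV j (x j) A') (rem j w)
  have h3 := card_sl2 j A' (fl_ne (x j)).symm
  have := h.c3
  omega
theorem meet (h : Loc A A' x y j w) : Meets (rem j x) (rem j y) := by
  obtain ⟨z, hz, hm, e⟩ := h.l4
  obtain ⟨q, h1, h2⟩ := meets_rem (i := j) hm
  have hr : Reg (slV j (w j) A') q := ⟨_, e ▸ rem_mem_slV hz, h1⟩
  exact ⟨q, (h.l3 h2).2 (Or.inr hr), (h.swap.l3 h2).2 (Or.inr hr)⟩
/-- if the only word of A' relevant is z -/
theorem same (h : Loc A A' x y j w) (hz : z ∈ A') (hzj : z j = w j)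
    (h1 : ∀ v ∈ A', v j ≠ x j) (h2 : ∀ v ∈ A', v j = w j → v = z) : rem j z = rem j x := by
  by_contra hne
  have e1 : slV j (x j) A' = ∅ := by
    rw [Finset.eq_empty_iff_forall_notMem]; intro v hv
    exact h1 _ (mem_slV.1 hv) (ins_same _ _ _)
  have e2 : slV j (w j) A' = {rem j z} := by
    ext v; rw [mem_singleton, mem_slV]
    constructor
    · intro hv; have := h2 _ hv (ins_same _ _ _); rw [← this, rem_ins]
    · rintro rfl; rw [← hzj, ins_rem]; exact hz
  have := lemC (Y := {rem j z}) (x := rem j x) (w := rem j w) (by rw [← e2]; exact h.gA'.sl _ _)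
    (by simpa using fun e => hne e.symm) (meets_rem h.f1) (fun q hq => by
      rw [h.l3 hq, e1, e2]; simp [Reg])
  have := this.trans (ft_card _ _)
  simp at this
theorem lemZ (h1 : Loc A A' x y j w1) (h2 : Loc A A' x y j w2) : w1 j = w2 j := by
  by_contra hne
  obtain ⟨z1, hz1, m1, e1⟩ := h1.l4
  obtain ⟨z2, hz2, m2, e2⟩ := h2.l4
  have hz12 : z1 ≠ z2 := by rintro rfl; exact hne (e1.symm.trans e2)
  have n2 : z2 ∉ ft A' w1 := by
    intro hc
    rcases h1.letters hz2 (mem_ft.1 hc).2 with e | e | e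
    · exact ne_of_fst h2.wj (e2.symm.trans e)
    · exact ne_fl_of_fst h2.wj (e2.symm.trans e)
    · exact hne (e.symm.trans e2)
  have n1 : z1 ∉ ft A' w2 := by
    intro hc
    rcases h2.letters hz1 (mem_ft.1 hc).2 with e | e | e
    · exact ne_of_fst h1.wj (e1.symm.trans e)
    · exact ne_fl_of_fst h1.wj (e1.symm.trans e)
    · exact hne (e1.symm.trans e)
  obtain ⟨u, hu, hu1⟩ := Finset.exists_mem_ne (s := ft A' w1) (by have := h1.ftA'; omega) z1
  obtain ⟨u', hu', hu2⟩ := Finset.exists_mem_ne (s := ft A' w2) (by have := h2.ftA'; omega) z2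
  have hu3 : u ≠ z2 := by rintro rfl; exact n2 hu
  have hu4 : u' ≠ z1 := by rintro rfl; exact n1 hu'
  have hA' : A' = {z1, z2, u} := by
    symm; apply Finset.eq_of_subset_of_card_le
    · intro v; simp only [mem_insert, mem_singleton]; rintro (rfl | rfl | rfl)
      exacts [hz1, hz2, ft_sub _ _ hu]
    · rw [Finset.card_eq_three.2 ⟨z1, z2, u, hz12, hu1.symm, hu3.symm, rfl⟩]; exact h1.c3
  have huu : u' = u := by
    have := ft_sub _ _ hu'; rw [hA'] at this; simp only [mem_insert, mem_singleton] at this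
    rcases this with e | e | e
    exacts [absurd e hu4, absurd e hu2, e]
  rw [huu] at hu'
  have key : ∀ {x y : Word K (n+1)}, Loc A A' x y j w1 → Loc A A' x y j w2 → u j ≠ x j → u j ≠ w1 j → u j ≠ w2 j → False := by
    intro x y h1 h2 hux hu1 hu2
    have hh : ∀ v ∈ A', v j ≠ x j := by
      intro v hv e; rw [hA'] at hv; simp only [mem_insert, mem_singleton] at hv
      rcases hv with rfl | rfl | rfl
      · exact ne_of_fst h1.wj (e1.symm.trans e)
      · exact ne_of_fst h2.wj (e2.symm.trans e)
      · exact hux e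
    have s1 := h1.same hz1 e1 hh (by
      intro v hv e; rw [hA'] at hv; simp only [mem_insert, mem_singleton] at hv
      rcases hv with rfl | rfl | rfl
      · rfl
      · exact absurd (e.symm.trans e2) hne
      · exact absurd e hu1)
    have s2 := h2.same hz2 e2 hh (by
      intro v hv e; rw [hA'] at hv; simp only [mem_insert, mem_singleton] at hv
      rcases hv with rfl | rfl | rfl
      · exact absurd (e1.symm.trans e) hne
      · rfl
      · exact absurd e hu2)
    have r1 := rem_mem_slV (i := j) hz1
    have r2 := rem_mem_slV (i := j) hz2
    rw [s1, e1] at r1; rw [s2, e2] at r2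
    by_cases hf : w2 j = fl (w1 j)
    · rw [hf] at r2; exact h1.gA'.sl_tw r1 r2
    · obtain ⟨q, hq⟩ := exists_mem (rem j x)
      exact h1.gA'.sl_sep hf hne r1 r2 hq hq
  have l1 := h1.letters (ft_sub _ _ hu) (mem_ft.1 hu).2
  have l2 := h2.letters (ft_sub _ _ hu) (mem_ft.1 hu').2
  have q1 := h1.wj
  have q2 := h2.wj
  have a1 : w1 j ≠ x j := ne_of_fst q1
  have a2 : w1 j ≠ fl (x j) := ne_fl_of_fst q1
  have a3 : w2 j ≠ x j := ne_of_fst q2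
  have a4 : w2 j ≠ fl (x j) := ne_fl_of_fst q2
  have hu5 : u j = x j ∨ u j = fl (x j) := by
    rcases l1 with e | e | e
    · exact Or.inl e
    · exact Or.inr e
    · rcases l2 with e' | e' | e'
      · exact Or.inl e'
      · exact Or.inr e'
      · exact absurd (e.symm.trans e') hne
  rcases hu5 with e | e
  · exact key h1.swap h2.swap (by rw [e, h1.hj]; exact (fl_ne _).symm) (by rw [e]; exact a1.symm) (by rw [e]; exact a3.symm)
  · exact key h1 h2 (by rw [e]; exact fl_ne _) (by rw [e]; exact a2.symm) (by rw [e]; exact a4.symm)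
end Loc

theorem split3 {α υ β ω : Word K d} {k : Fin d} (hk : υ k = fl (α k)) (h1 : Meets α ω) (h2 : Meets υ ω)
    (h : ∀ p, mem ω p → (mem β p ↔ (mem υ p ∨ mem α p))) : β k = ω k ∧ ∀ i, i ≠ k → α i = β i := by
  obtain ⟨p, p1, p2⟩ := h1
  obtain ⟨q, q1, q2⟩ := h2
  have i1 := incl p1 p2 (fun x a b => (h x b).2 (Or.inr a))
  have i2 := incl q1 q2 (fun x a b => (h x b).2 (Or.inl a))
  have hb : β k = ω k := by
    rcases i1 k with e | e
    · rcases i2 k with e' | e'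
      · rw [e', hk] at e; exact absurd e (fl_ne _)
      · exact e'
    · exact e
  refine ⟨hb, ?_⟩
  intro i hi
  by_contra hne
  have e1 : β i = ω i := (i1 i).resolve_left (fun e => hne e.symm)
  have m1 : Meets α ω := ⟨p, p1, p2⟩
  obtain ⟨B, hB1, hB2⟩ := two_lit (a := ω i) (b := fl (α i)) (by
    intro e; have := congrArg fl e; rw [fl_fl, fl_fl] at this; exact hne (this.trans e1.symm))
  let r := Function.update p i B
  have hr : ∀ m, m ≠ i → r m = p m := fun m hm => Function.update_of_ne hm _ _
  have hri : r i = B := Function.update_self _ _ _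
  have rω : mem ω r := by
    intro m; by_cases hm : m = i
    · subst hm; rw [hri]; exact hB1
    · rw [hr m hm]; exact p2 m
  have rβ : mem β r := by
    intro m; by_cases hm : m = i
    · subst hm; rw [hri, e1]; exact hB1
    · rw [hr m hm]
      rcases i1 m with e | e
      · rw [e]; exact p1 m
      · rw [e]; exact p2 m
  rcases (h r rω).1 rβ with hu | hu
  · have := hu k; rw [hr k hi.symm, hk, lit_fl] at this; exact this (p1 k)
  · have := hu i; rw [hri] at this; exact lit_fl.1 hB2 this

namespace Loc
variable {A A' : Finset (Word K (n+1))} {x y w w1 w2 z u : Word K (n+1)} {j : Fin (n+1)}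
theorem t1 (h : Loc A A' x y j w) (hA' : A' = {z, u}) (hzu : z ≠ u) (huj : u j = fl (x j)) :
    z j = w j ∧ rem j z = rem j x ∧ (∃ k, k ≠ j ∧ u k = fl (x k)) ∧
    ∀ k, k ≠ j → u k = fl (x k) → y k = w k ∧ ∀ i, i ≠ j → i ≠ k → x i = y i ∧ u i = y i := by
  have a1 := h.wj
  have huw : u j ≠ w j := by rw [huj]; exact (ne_fl_of_fst a1).symm
  have hz : z j = w j := by
    obtain ⟨v, hv, _, e⟩ := h.l4
    rw [hA'] at hv; simp only [mem_insert, mem_singleton] at hv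
    rcases hv with rfl | rfl
    · exact e
    · exact absurd e huw
  have zA : z ∈ A' := by rw [hA']; simp
  have uA : u ∈ A' := by rw [hA']; simp
  have hs : rem j z = rem j x := by
    apply h.same zA hz
    · intro v hv e; rw [hA'] at hv; simp only [mem_insert, mem_singleton] at hv
      rcases hv with rfl | rfl
      · exact ne_of_fst a1 (hz.symm.trans e)
      · rw [huj] at e; exact fl_ne _ e
    · intro v hv e; rw [hA'] at hv; simp only [mem_insert, mem_singleton] at hv
      rcases hv with rfl | rfl
      · rfl
      · exact absurd e huw
  have hzk : ∀ k, k ≠ j → z k = x k := by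
    intro k hk
    obtain ⟨m, rfl⟩ := Fin.exists_succAbove_eq hk
    exact congrFun hs m
  have hmu : Meets u w := by
    have h4 : ft A' w = A' := Finset.eq_of_subset_of_card_le (ft_sub _ _) (by
      have := h.ftA'; rw [hA', Finset.card_pair hzu]; rw [hA'] at this; exact this)
    rw [← h4] at uA; exact (mem_ft.1 uA).2
  refine ⟨hz, hs, ?_, ?_⟩
  · have : ¬ Meets z u := fun ⟨q, q1, q2⟩ => hzu (h.gA'.code z zA u uA q q1 q2)
    obtain ⟨k, hk⟩ := not_meets this
    have hkj : k ≠ j := by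
      rintro rfl; rw [huj, hz] at hk
      have := congrArg fl hk; rw [fl_fl, fl_fl] at this; exact ne_of_fst a1 this.symm
    exact ⟨k, hkj, by rw [hk, hzk k hkj]⟩
  · intro k hk huk
    have hreg : ∀ q, mem (rem j w) q → (mem (rem j y) q ↔ (mem (rem j u) q ∨ mem (rem j x) q)) := by
      intro q hq
      rw [h.swap.l3 hq]
      have e1 : slV j (y j) A' = {rem j u} := by
        ext v; rw [mem_singleton, mem_slV, hA', h.hj]; simp only [mem_insert, mem_singleton]
        constructor
        · rintro (e | e)
          · have := congrFun e j; rw [ins_same, hz] at this; exact absurd this.symm (ne_fl_of_fst a1)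
          · rw [← e, rem_ins]
        · rintro rfl; right; rw [← huj, ins_rem]
      have e2 : slV j (w j) A' = {rem j x} := by
        ext v; rw [mem_singleton, mem_slV, hA']; simp only [mem_insert, mem_singleton]
        constructor
        · rintro (e | e)
          · rw [← hs, ← e, rem_ins]
          · have := congrFun e j; rw [ins_same] at this; exact absurd this.symm huw
        · rintro rfl; left; rw [← hz, ← hs, ins_rem]
      rw [e1, e2, Reg_single, Reg_single]
    obtain ⟨m, rfl⟩ := Fin.exists_succAbove_eq hk
    have s1 := split3 (k := m) (α := rem j x) (υ := rem j u) (β := rem j y) (ω := rem j w) huk (meets_rem h.f1) (meets_rem hmu) hreg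
    have s2 := split3 (k := m) (α := rem j u) (υ := rem j x) (β := rem j y) (ω := rem j w) (by
      have : u (j.succAbove m) = _ := huk
      show x _ = fl (u _); rw [this, fl_fl]) (meets_rem hmu) (meets_rem h.f1) (fun p hp => (hreg p hp).trans or_comm)
    refine ⟨s1.1, ?_⟩
    intro i hi hik
    obtain ⟨m', rfl⟩ := Fin.exists_succAbove_eq hi
    have : m' ≠ m := fun e => hik (by rw [e])
    exact ⟨s1.2 m' this, s2.2 m' this⟩
end Loc
end PB
namespace PB
open Finset Classical
universe u
variable {K : Type u} {d n : ℕ} [Fintype K]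

theorem mem_cnt {A : Finset (Word K d)} {u} (hu : u ∈ A) {p} (hp : mem u p) : 0 < cnt A p := cnt_pos.2 ⟨u, hu, hp⟩

theorem lemXcore {α β : Word K d} {Pc Pd Pe : Bool → Finset (Word K d)} {Wc Wd We : Finset (Word K d)}
    (gPc : ∀ b, Good (Pc b)) (gPd : ∀ b, Good (Pd b)) (gPe : ∀ b, Good (Pe b))
    (gWc : Good Wc) (gWd : Good Wd) (gWe : Good We)
    (dc : ∀ b, Disjoint (Pc b) (Pc (!b))) (dd : ∀ b, Disjoint (Pd b) (Pd (!b))) (de : ∀ b, Disjoint (Pe b) (Pe (!b)))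
    (dcd : ∀ b, Disjoint (Pc b) (Pd b)) (hab : α ≠ β) (hα : α ∉ Wc) (hβ : β ∉ Wd)
    (hW : Wc.card + Wd.card + We.card ≤ 3) (hm : Wc.card + Wd.card + We.card = 3 → Meets α β)
    (ec : ∀ b x, cnt {α} x + cnt (Pc b) x + cnt (Pe b) x = cnt Wc x + cnt We x)
    (ed : ∀ b x, cnt {β} x + cnt (Pd b) x + cnt (Pe b) x = cnt Wd x + cnt We x) : False := by
  have vc : ∀ b, 1 + (Pc b).card + (Pe b).card = Wc.card + We.card := by
    intro b
    have := card_eq_of_cnt (A := {α}) (B := Pc b) (C := Pe b) (D := Wc) (E := We) (F := ∅) (by intro x; rw [cnt_empty, add_zero, ec])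
    simpa using this
  have vd : ∀ b, 1 + (Pd b).card + (Pe b).card = Wd.card + We.card := by
    intro b
    have := card_eq_of_cnt (A := {β}) (B := Pd b) (C := Pe b) (D := Wd) (E := We) (F := ∅) (by intro x; rw [cnt_empty, add_zero, ed])
    simpa using this
  have qc : ∀ b x, cnt (Pc b) x + cnt (Pe b) x = cnt (Pc (!b)) x + cnt (Pe (!b)) x := by
    intro b x; have := ec b x; have := ec (!b) x; omega
  have qd : ∀ b x, cnt (Pd b) x + cnt (Pe b) x = cnt (Pd (!b)) x + cnt (Pe (!b)) x := by
    intro b x; have := ed b x; have := ed (!b) x; omega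
  have empt : ∀ {A B : Finset (Word K d)}, Disjoint A B → Good B → B.card ≤ 4 → (∀ x, cnt A x ≤ cnt B x) → A = ∅ := by
    intro A B hd gB hB hle
    rw [Finset.eq_empty_iff_forall_notMem]; intro u hu
    exact Finset.disjoint_left.1 hd hu (cover_mem gB (fun p hp => cnt_pos.1 ((mem_cnt hu hp).trans_le (hle p))) hB)
  have hAll : ∀ b, Pe b = ∅ → Pc b = ∅ ∧ Pd b = ∅ := by
    intro b hb
    have hb0 : ∀ x, cnt (Pe b) x = 0 := by intro x; rw [hb, cnt_empty]
    have v1 := vc b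
    have v2 := vd b
    have c1 : Pc (!b) = ∅ := empt (dc b).symm (gPc b) (by omega) (fun x => by
      have := qc b x; have := hb0 x; have := cnt_nonneg (Pe (!b)) x; omega)
    have c2 : Pd (!b) = ∅ := empt (dd b).symm (gPd b) (by omega) (fun x => by
      have := qd b x; have := hb0 x; have := cnt_nonneg (Pe (!b)) x; omega)
    have hcd : ∀ x, cnt (Pc b) x = cnt (Pd b) x := by
      intro x
      have h1 := qc b x; have h2 := qd b x
      rw [c1, cnt_empty] at h1; rw [c2, cnt_empty] at h2
      omega
    exact ⟨empt (dcd b) (gPd b) (by omega) (fun x => (hcd x).le), empt (dcd b).symm (gPc b) (by omega) (fun x => (hcd x).ge)⟩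
  have hNo : ∀ b, Pe b ≠ ∅ := by
    intro b hb
    obtain ⟨h1, h2⟩ := hAll b hb
    have w1 := vc b
    have w2 := vd b
    rw [h1, hb] at w1; rw [h2, hb] at w2
    simp only [Finset.card_empty] at w1 w2
    have cα : ∀ p, mem α p → 0 < cnt Wc p + cnt We p := by
      intro p hp
      have := ec b p; have := mem_cnt (mem_singleton_self α) hp
      have := cnt_nonneg (Pc b) p; have := cnt_nonneg (Pe b) p; omega
    have cβ : ∀ p, mem β p → 0 < cnt Wd p + cnt We p := by
      intro p hp
      have := ed b p; have := mem_cnt (mem_singleton_self β) hp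
      have := cnt_nonneg (Pd b) p; have := cnt_nonneg (Pe b) p; omega
    by_cases hWe : We = ∅
    · rw [hWe] at cα
      exact hα (cover_mem gWc (fun p hp => cnt_pos.1 (by have := cα p hp; rw [cnt_empty] at this; omega)) (by omega))
    · have := Finset.card_pos.2 (Finset.nonempty_iff_ne_empty.2 hWe)
      have e1 : Wc = ∅ := Finset.card_eq_zero.1 (by omega)
      have e2 : Wd = ∅ := Finset.card_eq_zero.1 (by omega)
      have m1 : α ∈ We := cover_mem gWe (fun p hp => cnt_pos.1 (by have := cα p hp; rw [e1, cnt_empty] at this; omega)) (by omega)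
      have m2 : β ∈ We := cover_mem gWe (fun p hp => cnt_pos.1 (by have := cβ p hp; rw [e2, cnt_empty] at this; omega)) (by omega)
      exact hab (Finset.card_le_one.1 (by omega) _ m1 _ m2)
  have hc : ∀ b, Pc b ≠ ∅ := by
    intro b hb
    refine hNo (!b) (empt (de b).symm (gPe b) (by have := vc b; omega) (fun x => ?_))
    have := qc b x; rw [hb, cnt_empty] at this; have := cnt_nonneg (Pc (!b)) x; omega
  have hd : ∀ b, Pd b ≠ ∅ := by
    intro b hb
    refine hNo (!b) (empt (de b).symm (gPe b) (by have := vd b; omega) (fun x => ?_))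
    have := qd b x; rw [hb, cnt_empty] at this; have := cnt_nonneg (Pd (!b)) x; omega
  have p1 := Finset.card_pos.2 (Finset.nonempty_iff_ne_empty.2 (hNo true))
  have p2 := Finset.card_pos.2 (Finset.nonempty_iff_ne_empty.2 (hc true))
  have p3 := Finset.card_pos.2 (Finset.nonempty_iff_ne_empty.2 (hd true))
  have w1 := vc true
  have w2 := vd true
  have e1 : Wc = ∅ := Finset.card_eq_zero.1 (by omega)
  have e2 : Wd = ∅ := Finset.card_eq_zero.1 (by omega)
  have m1 : α ∈ We := cover_mem gWe (fun p hp => cnt_pos.1 (by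
    have := ec true p; rw [e1, cnt_empty] at this; have := mem_cnt (mem_singleton_self α) hp
    have := cnt_nonneg (Pc true) p; have := cnt_nonneg (Pe true) p; omega)) (by omega)
  have m2 : β ∈ We := cover_mem gWe (fun p hp => cnt_pos.1 (by
    have := ed true p; rw [e2, cnt_empty] at this; have := mem_cnt (mem_singleton_self β) hp
    have := cnt_nonneg (Pd true) p; have := cnt_nonneg (Pe true) p; omega)) (by omega)
  obtain ⟨q, q1, q2⟩ := hm (by omega)
  exact hab (gWe.code _ m1 _ m2 q q1 q2)

structure Oct (O : Bool → Bool → Bool → Finset (Word K d)) : Prop where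
  good : ∀ a p b, Good (O a p b)
  dsign : ∀ a p b, Disjoint (O a p b) (O a p (!b))
  dVW : ∀ a p b, Disjoint (O a p b) (O (!a) p b)
  sep : ∀ a p b b' x, Reg (O a p b) x → ¬ Reg (O a (!p) b') x
  eq : ∀ a p b b' x, cnt (O a p b) x + cnt (O a (!p) b') x = cnt (O (!a) p b) x + cnt (O (!a) (!p) b') x

theorem sl_disj {A B : Finset (Word K (n+1))} (h : Disjoint A B) (i s) : Disjoint (slV i s A) (slV i s B) :=
  Finset.disjoint_left.2 fun _ h1 h2 => Finset.disjoint_left.1 h (mem_slV.1 h1) (mem_slV.1 h2)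
theorem sl_empty {A : Finset (Word K (n+1))} {i s} (h : ∀ v ∈ A, v i ≠ s) : slV i s A = ∅ := by
  rw [Finset.eq_empty_iff_forall_notMem]; intro u hu
  exact h _ (mem_slV.1 hu) (ins_same _ _ _)

theorem lemX {O : Bool → Bool → Bool → Finset (Word K (n+1))} (hO : Oct O) (a p b : Bool) {x y : Word K (n+1)} {j : Fin (n+1)}
    {e : K × Bool} (hA : O a p b = {x, y}) (hj : y j = fl (x j)) (he : e.1 ≠ (x j).1)
    (hW : (O (!a) p b).card ≤ 3) (hm : (O (!a) p b).card = 3 → Meets (rem j x) (rem j y))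
    (hw : ∀ b', ∀ w ∈ O (!a) (!p) b', w j = e)
    (hcol : ∀ a p b, ∀ v ∈ O a p b, (v j).1 = (x j).1 ∨ (v j).1 = e.1) : False := by
  have xA : x ∈ O a p b := by rw [hA]; simp
  have yA : y ∈ O a p b := by rw [hA]; simp
  have key : ∀ c : K × Bool, c.1 = (x j).1 → ∀ b' q, cnt (slV j c (O a p b)) q + cnt (slV j c (O a (!p) b')) q + cnt (slV j (fl e) (O a (!p) b')) q
      = cnt (slV j c (O (!a) p b)) q + cnt (slV j (fl e) (O (!a) p b)) q := by
    intro c hc b' q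
    have hec : e.1 ≠ c.1 := by rw [hc]; exact he
    obtain ⟨B, hB1, hB2⟩ := two_lit (a := c) (b := fl e) (ne_fl_of_fst hec)
    have hce : c ≠ fl e := ne_fl_of_fst hec.symm
    have hl : ∀ a p b, ∀ v ∈ O a p b, lit B (v j) → v j = c ∨ v j = fl e := by
      intro a p b v hv hl
      rcases hcol a p b v hv with h | h
      · left; exact lit_eq hl hB1 (h.trans hc.symm)
      · right; exact lit_eq hl hB2 h
    have := hO.eq a p b b' (ins j B q)
    rw [cnt_two j _ hB1 hB2 hce (hl _ _ _), cnt_two j _ hB1 hB2 hce (hl _ _ _), cnt_two j _ hB1 hB2 hce (hl _ _ _), cnt_two j _ hB1 hB2 hce (hl _ _ _)] at this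
    have z1 : slV j (fl e) (O a p b) = ∅ := sl_empty (by
      rw [hA]; intro v hv; simp only [mem_insert, mem_singleton] at hv
      rcases hv with rfl | rfl
      · exact ne_fl_of_fst he.symm
      · rw [hj]; intro h; exact he (by have := congrArg Prod.fst h; exact this.symm))
    have z2 : slV j c (O (!a) (!p) b') = ∅ := sl_empty (by
      intro v hv h; rw [hw _ v hv] at h; exact hec (by rw [h]))
    have z3 : slV j (fl e) (O (!a) (!p) b') = ∅ := sl_empty (by
      intro v hv h; rw [hw _ v hv] at h; exact fl_ne _ h.symm)
    rw [z1, z2, z3, cnt_empty] at this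
    omega
  have sx : slV j (x j) (O a p b) = {rem j x} := by
    ext v; rw [mem_singleton, mem_slV, hA]; simp only [mem_insert, mem_singleton]
    constructor
    · rintro (h | h)
      · rw [← h, rem_ins]
      · have := congrFun h j; rw [ins_same, hj] at this; exact absurd this.symm (fl_ne _)
    · rintro rfl; left; rw [ins_rem]
  have sy : slV j (fl (x j)) (O a p b) = {rem j y} := by
    ext v; rw [mem_singleton, mem_slV, hA]; simp only [mem_insert, mem_singleton]
    constructor
    · rintro (h | h)
      · have := congrFun h j; rw [ins_same] at this; exact absurd this (fl_ne _)
      · rw [← h, rem_ins]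
    · rintro rfl; right; rw [← hj, ins_rem]
  have c3 := card_sl3 j (O (!a) p b) (a := x j) (b := fl (x j)) (c := fl e) (fl_ne _).symm (ne_fl_of_fst he.symm)
    (by intro h; exact he (by have := congrArg Prod.fst h; exact this.symm))
  have gS := fun a p b s => (hO.good a p b).sl j s
  refine lemXcore (α := rem j x) (β := rem j y) (Pc := fun b' => slV j (x j) (O a (!p) b')) (Pd := fun b' => slV j (fl (x j)) (O a (!p) b'))
    (Pe := fun b' => slV j (fl e) (O a (!p) b')) (Wc := slV j (x j) (O (!a) p b)) (Wd := slV j (fl (x j)) (O (!a) p b)) (We := slV j (fl e) (O (!a) p b))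
    (fun _ => gS _ _ _ _) (fun _ => gS _ _ _ _) (fun _ => gS _ _ _ _) (gS _ _ _ _) (gS _ _ _ _) (gS _ _ _ _)
    (fun _ => sl_disj (hO.dsign _ _ _) _ _) (fun _ => sl_disj (hO.dsign _ _ _) _ _) (fun _ => sl_disj (hO.dsign _ _ _) _ _)
    (fun b' => Finset.disjoint_left.2 fun v h1 h2 => (hO.good _ _ _).sl_tw h1 h2) ?_ ?_ ?_ (by omega) (fun h => hm (by omega)) ?_ ?_
  · intro h
    refine (hO.good a p b).sl_tw (i := j) (s := x j) (u := rem j x) ?_ ?_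
    · rw [sx]; simp
    · rw [sy, h]; simp
  · intro h; rw [mem_slV, ins_rem] at h; exact Finset.disjoint_left.1 (hO.dVW a p b) xA h
  · intro h; rw [mem_slV, ← hj, ins_rem] at h; exact Finset.disjoint_left.1 (hO.dVW a p b) yA h
  · intro b' q; rw [← key _ rfl, sx]
  · intro b' q; rw [← key (fl (x j)) rfl, sy]
end PB
namespace PB
open Finset Classical
universe u
variable {K : Type u} {d n : ℕ} [Fintype K]

def Pm (A : Finset (Word K d)) (w : Word K d) : Prop := ∃ q, mem w q ∧ Reg A q

namespace Oct
section
variable {O : Bool → Bool → Bool → Finset (Word K d)}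

theorem cardeq (hO : Oct O) (a p b b') : (O a p b).card + (O a (!p) b').card = (O (!a) p b).card + (O (!a) (!p) b').card :=
  card_eq2 (hO.eq a p b b')
theorem onw' (hO : Oct O) {a p a' p'} (ha : a' = !a) (hp : p' = !p) {b b' w x} (hw : w ∈ O a' p' b') (hx : mem w x) :
    cnt (O a p b) x + cnt (O a p' b') x = 1 := by
  subst ha hp
  rw [hO.eq a p b b' x, cnt_good (hO.good _ _ _), cnt_good (hO.good _ _ _), if_neg, if_pos]
  · rfl
  · exact ⟨w, hw, hx⟩
  · intro h; exact hO.sep _ _ _ b' _ h ⟨w, hw, hx⟩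
theorem onw (hO : Oct O) {a p a' p'} (ha : a' = !a) (hp : p' = !p) {b b2 b' w x} (hw : w ∈ O a' p' b') (hx : mem w x) :
    Reg (O a p b) x ↔ Reg (O a p b2) x := by
  apply reg_of_cnt
  have := hO.onw' ha hp (b := b) hw hx
  have := hO.onw' ha hp (b := b2) hw hx
  omega
theorem rest5 (hO : Oct O) {a p a' p'} (ha : a' = !a) (hp : p' = !p) {b b' w} (hw : w ∈ O a' p' b') (h : ¬ Pm (O a p b) w) :
    5 ≤ (O a p' b').card := by
  apply cover5 _ w (hO.good _ _ _)
  · subst ha; exact Finset.disjoint_right.1 (hO.dVW a p' b') hw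
  · intro q hq
    have := hO.onw' ha hp (b := b) hw hq
    rw [cnt_zero.2 (fun hr => h ⟨q, hq, hr⟩)] at this
    exact cnt_pos.1 (by omega)
/-- a P point gives words on the other side -/
theorem other (hO : Oct O) {a p a' p'} (ha : a' = !a) (hp : p' = !p) {b x} (h1 : Reg (O a p b) x) (h2 : ¬ Reg (O a' p b) x) (b') :
    Reg (O a' p' b') x := by
  subst ha hp
  have := hO.eq a p b b' x
  have h3 := cnt_pos.2 h1
  rw [cnt_zero.2 h2] at this
  have := cnt_nonneg (O a (!p) b') x
  exact cnt_pos.1 (by omega)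
theorem dich {A : Finset (Word K d)} (h : Good A) {x y} (hx : x ∈ A) (hy : y ∈ A) (hne : x ≠ y) : ∃ j, y j = fl (x j) :=
  not_meets (fun ⟨q, q1, q2⟩ => hne (h.code _ hx _ hy q q1 q2))
theorem five (hO : Oct O) {a p a' p'} (ha : a' = !a) (hp : p' = !p) {b} (hP : ∃ x, Reg (O a p b) x ∧ ¬ Reg (O a' p b) x)
    {b1 : Bool} (h1 : (O a' p' b1).card = 1) : 5 ≤ ((O a' p' (!b1)).filter (Pm (O a p b))).card := by
  obtain ⟨q, hq, hq'⟩ := hP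
  have r1 := hO.other ha hp hq hq' b1
  obtain ⟨v, hv, hvq⟩ := hq
  have hv' : v ∈ O (!a') (!p') b := by subst ha hp; simpa using hv
  have hh := lemD1 (A := O a' p' b1) (A' := O a' p' (!b1)) (w := v) (hO.good _ _ _) (hO.dsign _ _ _)
    (fun y hy => hO.onw rfl rfl hv' hy) (by have := ft_pos hvq r1; have := ft_card (O a' p' b1) v; omega)
  refine hh.trans (Finset.card_le_card ?_)
  intro w hw
  rw [mem_ft] at hw
  obtain ⟨h2, y, y1, y2⟩ := hw
  exact mem_filter.2 ⟨h2, y, y1, v, hv, y2⟩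
theorem arith (hO : Oct O) {a p a' p'} (ha : a' = !a) (hp : p' = !p) {b : Bool}
    (hP : ∃ x, Reg (O a p b) x ∧ ¬ Reg (O a' p b) x) (hN : ∃ x, Reg (O a' p b) x ∧ ¬ Reg (O a p b) x)
    (l1 : 2 ≤ (O a p b).card) (l2 : 2 ≤ (O a p (!b)).card) (l3 : 2 ≤ (O a' p b).card) (l4 : 2 ≤ (O a' p (!b)).card)
    {b' w} (hw : w ∈ O a' p' b') (hr : ¬ Pm (O a p b) w)
    (tot : (O a p b).card + (O a p (!b)).card + (O a' p b).card + (O a' p (!b)).card +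
      (O a p' b').card + (O a p' (!b')).card + (O a' p' b').card + (O a' p' (!b')).card ≤ 22) :
    (((O a p b).card = 2 ∧ (O a p (!b)).card = 2) ∧ ((O a' p b).card = 2 ∧ (O a' p (!b)).card = 2)) ∧
    ((((O a p' b').card = 5 ∧ (O a p' (!b')).card = 2) ∧ ((O a' p' b').card = 5 ∧ (O a' p' (!b')).card = 2)) ∨
     (((O a p' b').card = 6 ∧ (O a p' (!b')).card = 1) ∧ ((O a' p' b').card = 6 ∧ (O a' p' (!b')).card = 1))) := by
  have f1 := hO.rest5 ha hp hw hr
  have e1 := hO.cardeq a p b b'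
  have e2 := hO.cardeq a p b (!b')
  have e3 := hO.cardeq a p (!b) b'
  have f2 : 1 ≤ (O a p' (!b')).card := by
    obtain ⟨q, h1, h2⟩ := hN
    obtain ⟨v, hv, _⟩ := hO.other (a := a') (a' := a) (by rw [ha]; simp) hp h1 h2 (!b')
    exact Finset.card_pos.2 ⟨v, hv⟩
  have f3 : 6 ≤ (O a' p' b').card ∨ (2 ≤ (O a' p' (!b')).card) := by
    by_cases h1 : (O a' p' (!b')).card = 1
    · left
      have := hO.five ha hp hP h1
      rw [Bool.not_not] at this
      have h2 : (O a' p' b').filter (Pm (O a p b)) ⊂ O a' p' b' := by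
        refine Finset.filter_ssubset.2 ⟨w, hw, hr⟩
      have := Finset.card_lt_card h2
      omega
    · right
      obtain ⟨q, h3, h2⟩ := hP
      obtain ⟨v, hv, _⟩ := hO.other ha hp h3 h2 (!b')
      have := Finset.card_pos.2 ⟨v, hv⟩
      omega
  subst ha hp
  omega
end

section
variable {O : Bool → Bool → Bool → Finset (Word K (n+1))}
theorem mkLoc (hO : Oct O) {a p a' p'} (ha : a' = !a) (hp : p' = !p) {b b' x y j w} (hA : O a p b = {x, y}) (hj : y j = fl (x j))
    (h3 : (O a p (!b)).card ≤ 3) (hw : w ∈ O a' p' b') (hm : Pm (O a p b) w) : Loc (O a p b) (O a p (!b)) x y j w :=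
  ⟨hO.good _ _ _, hO.good _ _ _, hO.dsign _ _ _, hA, hj, h3, fun _ hq => hO.onw ha hp hw hq, hm⟩

theorem noRest (hO : Oct O) (a p b : Bool) (hP : ∃ x, Reg (O a p b) x ∧ ¬ Reg (O (!a) p b) x)
    (h2 : (O a p b).card = 2) (h3 : (O a p (!b)).card ≤ 3) (h4 : (O (!a) p b).card ≤ 3)
    (hcol : ∀ j, ∃ k1 k2, ∀ a p b, ∀ v ∈ O a p b, (v j).1 = k1 ∨ (v j).1 = k2)
    (hr : ∀ b', ∀ w ∈ O (!a) (!p) b', Pm (O a p b) w) : False := by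
  obtain ⟨x, y, hxy, hA⟩ := Finset.card_eq_two.1 h2
  have xA : x ∈ O a p b := by rw [hA]; simp
  have yA : y ∈ O a p b := by rw [hA]; simp
  obtain ⟨j, hj⟩ := dich (hO.good a p b) xA yA hxy
  obtain ⟨q, hq, hq'⟩ := hP
  obtain ⟨w0, hw0, _⟩ := hO.other rfl rfl hq hq' true
  have L : ∀ b', ∀ w ∈ O (!a) (!p) b', Loc (O a p b) (O a p (!b)) x y j w := fun b' w hw =>
    hO.mkLoc rfl rfl hA hj h3 hw (hr b' w hw)
  have L0 := L _ _ hw0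
  refine lemX hO a p b hA hj L0.wj h4 (fun _ => L0.meet) (fun b' w hw => (L b' w hw).lemZ L0) ?_
  obtain ⟨k1, k2, hk⟩ := hcol j
  intro a2 p2 b2 v hv
  have q1 := hk _ _ _ v hv
  have q2 := hk _ _ _ x xA
  have q3 := hk _ _ _ w0 hw0
  have q4 := L0.wj
  rcases q1 with q1 | q1 <;> rcases q2 with q2 | q2 <;> rcases q3 with q3 | q3 <;> rw [q1, q2, q3] <;> rw [q2, q3] at q4 <;> simp at q4 ⊢

theorem sq (hO : Oct O) {a p a' p'} (ha : a' = !a) (hp : p' = !p) {b b0 w0} (h2 : (O a p b).card = 2) (h2' : (O a p (!b)).card = 2)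
    (hw0 : w0 ∈ O a' p' b0) (hm0 : Pm (O a p b) w0) :
    ∃ x y z u j k, O a p b = {x, y} ∧ O a p (!b) = {z, u} ∧ k ≠ j ∧ y j = fl (x j) ∧
      (∀ i, i ≠ j → i ≠ k → x i = y i ∧ u i = y i ∧ z i = y i) ∧
      ∀ b', ∀ w ∈ O a' p' b', Pm (O a p b) w → Meets x w ∧ Meets y w ∧ w j = z j ∧ w k = y k ∧ (w j).1 ≠ (x j).1 ∧ (w k).1 ≠ (x k).1 := by
  obtain ⟨x, y, hxy, hA⟩ := Finset.card_eq_two.1 h2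
  have xA : x ∈ O a p b := by rw [hA]; simp
  have yA : y ∈ O a p b := by rw [hA]; simp
  obtain ⟨j, hj⟩ := dich (hO.good a p b) xA yA hxy
  obtain ⟨z, hz, _, hzj⟩ := (hO.mkLoc ha hp hA hj (by omega) hw0 hm0).l4
  obtain ⟨u, hu, huz⟩ := Finset.exists_mem_ne (s := O a p (!b)) (by omega) z
  have hA' : O a p (!b) = {z, u} := by
    symm; apply Finset.eq_of_subset_of_card_le
    · intro v; simp only [mem_insert, mem_singleton]; rintro (rfl | rfl)
      exacts [hz, hu]
    · rw [Finset.card_pair huz.symm]; omega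
  have L0 := hO.mkLoc ha hp hA hj (by omega) hw0 hm0
  have hum : Meets u w0 := by
    have h4 : ft (O a p (!b)) w0 = O a p (!b) := Finset.eq_of_subset_of_card_le (ft_sub _ _) (by
      have := L0.ftA'; omega)
    rw [← h4] at hu; exact (mem_ft.1 hu).2
  have main : ∀ x y, O a p b = {x, y} → y j = fl (x j) → u j = fl (x j) → ∃ x y z u j k, O a p b = {x, y} ∧ O a p (!b) = {z, u} ∧ k ≠ j ∧ y j = fl (x j) ∧
      (∀ i, i ≠ j → i ≠ k → x i = y i ∧ u i = y i ∧ z i = y i) ∧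
      ∀ b', ∀ w ∈ O a' p' b', Pm (O a p b) w → Meets x w ∧ Meets y w ∧ w j = z j ∧ w k = y k ∧ (w j).1 ≠ (x j).1 ∧ (w k).1 ≠ (x k).1 := by
    clear hA hj xA yA hxy L0
    intro x y hA hj huj
    have xA : x ∈ O a p b := by rw [hA]; simp
    have yA : y ∈ O a p b := by rw [hA]; simp
    have L : ∀ b', ∀ w ∈ O a' p' b', Pm (O a p b) w → Loc (O a p b) (O a p (!b)) x y j w := fun b' w hw hm =>
      hO.mkLoc ha hp hA hj (by omega) hw hm
    obtain ⟨_, hs, ⟨k, hkj, hk⟩, t4⟩ := (L _ _ hw0 hm0).t1 hA' huz.symm huj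
    have t5 := (t4 k hkj hk).2
    have hzx : ∀ i, i ≠ j → z i = x i := by
      intro i hi
      obtain ⟨m, rfl⟩ := Fin.exists_succAbove_eq hi
      exact congrFun hs m
    refine ⟨x, y, z, u, j, k, hA, hA', hkj, hj, ?_, ?_⟩
    · intro i h1 h2
      exact ⟨(t5 i h1 h2).1, (t5 i h1 h2).2, (hzx i h1).trans (t5 i h1 h2).1⟩
    · intro b' w hw hm
      have Lw := L b' w hw hm
      have tw := Lw.t1 hA' huz.symm huj
      have hyk := (tw.2.2.2 k hkj hk).1
      refine ⟨Lw.f1, Lw.swap.f1, tw.1.symm, hyk.symm, Lw.wj, ?_⟩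
      apply ne_fst _ (Lw.f1.ne k)
      intro e
      refine (hO.good a p b).tf x xA y yA j ?_ hj
      intro i hi
      by_cases hik : i = k
      · subst hik; rw [hyk, e]
      · exact (t5 i hi hik).1
  have hul := L0.letters hu hum
  rcases hul with e | e | e
  · exact main y x (by rw [hA, Finset.pair_comm]) (by rw [hj, fl_fl]) (by rw [e, hj, fl_fl])
  · exact main x y hA hj e
  · exfalso
    have hs := L0.lemZ L0
    have nx : ∀ v ∈ O a p (!b), v j = w0 j := by
      intro v hv; rw [hA'] at hv; simp only [mem_insert, mem_singleton] at hv
      rcases hv with rfl | rfl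
      exacts [hzj, e]
    -- all of A' has letter w0 j
    have hsub : ∀ q, mem (rem j w0) q → (mem (rem j x) q ↔ Reg (slV j (w0 j) (O a p (!b))) q) := by
      intro q hq
      rw [L0.l3 hq, sl_empty (s := x j) (by intro v hv; rw [nx v hv]; exact ne_of_fst L0.wj)]
      simp [Reg]
    have hsub' : ∀ q, mem (rem j w0) q → (mem (rem j y) q ↔ Reg (slV j (w0 j) (O a p (!b))) q) := by
      intro q hq
      rw [L0.swap.l3 hq, sl_empty (s := y j) (by intro v hv; rw [nx v hv]; exact ne_of_fst L0.swap.wj)]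
      simp [Reg]
    have gS := (hO.good a p (!b)).sl j (w0 j)
    have cS : (slV j (w0 j) (O a p (!b))).card ≤ 2 := by
      have := card_sl2 j (O a p (!b)) (fl_ne (w0 j)).symm; omega
    have key : ∀ x y, Loc (O a p b) (O a p (!b)) x y j w0 → (∀ q, mem (rem j w0) q → (mem (rem j x) q ↔ Reg (slV j (w0 j) (O a p (!b))) q)) →
        rem j x ∈ slV j (w0 j) (O a p (!b)) := by
      intro x y L hs
      by_contra hc
      have := lemC gS hc (meets_rem L.f1) (fun q hq => (hs q hq).symm)
      have := this.trans (ft_card _ _)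
      omega
    have kx := key x y L0 hsub
    have ky := key y x L0.swap hsub'
    have : rem j x = rem j y := by
      obtain ⟨q, q1, q2⟩ := L0.meet
      exact gS.code _ kx _ ky q q1 q2
    refine (hO.good a p b).tf x xA y yA j ?_ hj
    intro i hi
    obtain ⟨m, rfl⟩ := Fin.exists_succAbove_eq hi
    exact congrFun this m

theorem caseII (hO : Oct O) (a p b b1 : Bool)
    (h2 : (O a p b).card = 2) (h2' : (O a p (!b)).card = 2)
    (hv : (O a (!p) b1).card = 2) (hw : (O (!a) (!p) b1).card = 2)
    (hcol : ∀ j, ∃ k1 k2, ∀ a p b, ∀ v ∈ O a p b, (v j).1 = k1 ∨ (v j).1 = k2) : False := by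
  have pm : ∀ w ∈ O (!a) (!p) b1, Pm (O a p b) w := by
    intro w hw; by_contra hc
    have := hO.rest5 rfl rfl hw hc; omega
  obtain ⟨w1, w2, hne, hW⟩ := Finset.card_eq_two.1 hw
  have m1 : w1 ∈ O (!a) (!p) b1 := by rw [hW]; simp
  have m2 : w2 ∈ O (!a) (!p) b1 := by rw [hW]; simp
  obtain ⟨x, y, z, u, j, k, hA, hA', hkj, hj, hoff, hall⟩ := hO.sq rfl rfl h2 h2' m1 (pm _ m1)
  obtain ⟨q, hq⟩ := dich (hO.good _ _ _) m1 m2 hne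
  have r1 := hall _ _ m1 (pm _ m1)
  have r2 := hall _ _ m2 (pm _ m2)
  have hqj : q ≠ j := by rintro rfl; rw [r1.2.2.1, r2.2.2.1] at hq; exact fl_ne _ hq.symm
  have hqk : q ≠ k := by rintro rfl; rw [r1.2.2.2.1, r2.2.2.2.1] at hq; exact fl_ne _ hq.symm
  obtain ⟨o1, o2, o3⟩ := hoff q hqj hqk
  have he : (y q).1 ≠ (w1 q).1 := by
    apply ne_fst
    · intro e; apply r2.2.1.ne q; rw [hq, e]
    · intro e; apply r1.2.1.ne q; rw [e, fl_fl]
  have xA : x ∈ O a p b := by rw [hA]; simp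
  have yA : y ∈ O a p b := by rw [hA]; simp
  have hle : ∀ b', ∀ v ∈ O a p b', v q = y q := by
    intro b' v hv
    have hb : b' = b ∨ b' = !b := by cases b' <;> cases b <;> simp
    rcases hb with rfl | rfl
    · rw [hA] at hv; simp only [mem_insert, mem_singleton] at hv
      rcases hv with rfl | rfl
      exacts [o1, rfl]
    · rw [hA'] at hv; simp only [mem_insert, mem_singleton] at hv
      rcases hv with rfl | rfl
      exacts [o3, o2]
  refine lemX hO (!a) (!p) b1 hW hq he (by rw [Bool.not_not]; omega) (by rw [Bool.not_not]; omega)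
    (by simpa using hle) ?_
  obtain ⟨k1, k2, hk⟩ := hcol q
  intro a2 p2 b2 v hv
  have q1 := hk _ _ _ v hv
  have q2 := hk _ _ _ y yA
  have q3 := hk _ _ _ w1 m1
  rcases q1 with q1 | q1 <;> rcases q2 with q2 | q2 <;> rcases q3 with q3 | q3 <;> rw [q1, q2, q3] <;> rw [q2, q3] at he <;> simp at he ⊢

theorem sideI (hO : Oct O) {a p a' p'} (ha : a' = !a) (hp : p' = !p) {b b1 : Bool}
    (h2 : (O a p b).card = 2) (h2' : (O a p (!b)).card = 2) {v' w'}
    (hv : O a p' b1 = {v'}) (hw : O a' p' b1 = {w'}) :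
    ∃ j k, (v' j).1 ≠ (w' j).1 ∧ (v' k).1 ≠ (w' k).1 ∧ (∀ i, i ≠ j → i ≠ k → v' i = w' i) ∧
      ∀ w ∈ O a' p' (!b1), Pm (O a p b) w → w j = w' j ∧ w k = w' k := by
  have hw' : w' ∈ O a' p' b1 := by rw [hw]; simp
  have hv' : v' ∈ O a p' b1 := by rw [hv]; simp
  have pm : Pm (O a p b) w' := by
    by_contra hc
    have := hO.rest5 ha hp hw' hc; rw [hv] at this; simp at this
  obtain ⟨x, y, z, u, j, k, hA, hA', hkj, hj, hoff, hall⟩ := hO.sq ha hp h2 h2' hw' pm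
  have xA : x ∈ O a p b := by rw [hA]; simp
  have yA : y ∈ O a p b := by rw [hA]; simp
  obtain ⟨mx, my, wj, wk, nj, nk⟩ := hall _ _ hw' pm
  let g : Word K (n+1) := Function.update (Function.update w' j (x j)) k (fl (x k))
  have gk : g k = fl (x k) := Function.update_self _ _ _
  have gj : g j = x j := by show Function.update _ _ _ _ = _; rw [Function.update_of_ne hkj.symm, Function.update_self]
  have go : ∀ i, i ≠ j → i ≠ k → g i = w' i := by
    intro i h1 h2; show Function.update _ _ _ _ = _; rw [Function.update_of_ne h2, Function.update_of_ne h1]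
  have gm : Meets g w' := by
    apply meets_of
    intro i
    by_cases h1 : i = j
    · subst h1; rw [gj]; exact ne_fl_of_fst nj
    by_cases h2 : i = k
    · subst h2; rw [gk, fl_fl]; exact ne_of_fst nk
    · rw [go i h1 h2]; exact (fl_ne _).symm
  obtain ⟨q, q1, q2⟩ := gm
  have hin := incl q1 q2 (a := v') (fun r r1 r2 => by
    have h1 := hO.onw' ha hp (b := b) hw' r2
    have h2 : ¬ Reg (O a p b) r := by
      rw [hA]; rintro ⟨v, hv, hm⟩; simp only [mem_insert, mem_singleton] at hv
      rcases hv with rfl | rfl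
      · have := r1 k; rw [gk, lit_fl] at this; exact this (hm k)
      · have := r1 j; rw [gj] at this; have h3 := hm j; rw [hj, lit_fl] at h3; exact h3 this
    rw [cnt_zero.2 h2] at h1
    have h3 : Reg (O a p' b1) r := cnt_pos.1 (by omega)
    rw [hv, Reg_single] at h3; exact h3)
  have off : ∀ i, i ≠ j → i ≠ k → v' i = w' i := by
    intro i h1 h2
    have := hin i; rw [go i h1 h2] at this; simpa using this
  have sepx : ∀ t ∈ O a p b, ∃ i, v' i = fl (t i) := by
    intro t ht
    apply not_meets
    rintro ⟨r, r1, r2⟩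
    subst hp
    exact hO.sep a p b b1 r ⟨t, ht, r1⟩ ⟨v', hv', r2⟩
  have vk : v' k = fl (x k) := by
    obtain ⟨i, hi⟩ := sepx x xA
    by_cases h1 : i = j
    · subst h1; exfalso
      rcases hin i with e | e
      · rw [gj] at e; rw [e] at hi; exact fl_ne _ hi.symm
      · rw [e] at hi; exact ne_fl_of_fst nj hi
    by_cases h2 : i = k
    · subst h2; exact hi
    · exfalso; rw [off i h1 h2] at hi; exact mx.ne i hi
  have vj : v' j = x j := by
    obtain ⟨i, hi⟩ := sepx y yA
    by_cases h1 : i = j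
    · subst h1; rw [hi, hj, fl_fl]
    by_cases h2 : i = k
    · subst h2; exfalso; rw [vk] at hi
      have := congrArg Prod.fst hi
      apply nk; rw [wk]; exact this.symm
    · exfalso; rw [off i h1 h2] at hi; exact my.ne i hi
  refine ⟨j, k, by rw [vj]; exact nj.symm, by rw [vk]; exact nk.symm, off, ?_⟩
  intro w hw hm
  have := hall _ w hw hm
  exact ⟨this.2.2.1.trans wj.symm, this.2.2.2.1.trans wk.symm⟩

theorem four {A B C D E F G H : Finset (Word K d)} (h : ∀ x, cnt A x + cnt B x + cnt C x + cnt D x = cnt E x + cnt F x + cnt G x + cnt H x) :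
    A.card + B.card + C.card + D.card = E.card + F.card + G.card + H.card := by
  obtain ⟨N, hN, hv⟩ := vol (K := K) (d := d)
  have := Finset.sum_congr rfl (fun x (_ : x ∈ (univ : Finset (Pt K d))) => h x)
  simp only [Finset.sum_add_distrib, hv] at this
  have h2 : N * ((A.card + B.card + C.card + D.card : ℕ) : ℤ) = N * ((E.card + F.card + G.card + H.card : ℕ) : ℤ) := by
    push_cast; linarith
  exact_mod_cast mul_left_cancel₀ hN.ne' h2

theorem fil_le {A : Finset (Word K (n+1))} {P : Word K (n+1) → Prop} {j s} (h : ∀ w ∈ A, P w → w j = s) : (A.filter P).card ≤ (slV j s A).card := by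
  refine Finset.card_le_card_of_injOn (fun w => rem j w) ?_ ?_
  · intro w hw
    have hw' := mem_filter.1 hw
    have := rem_mem_slV (i := j) hw'.1
    rw [h w hw'.1 hw'.2] at this; exact this
  · intro w hw v hv e
    have hw' := mem_filter.1 hw
    have hv' := mem_filter.1 hv
    rw [← ins_rem j w, ← ins_rem j v, h w hw'.1 hw'.2, h v hv'.1 hv'.2]
    exact congrArg _ e

theorem caseI (hO : Oct O) (a p b b1 : Bool)
    (hP : ∃ x, Reg (O a p b) x ∧ ¬ Reg (O (!a) p b) x) (hN : ∃ x, Reg (O (!a) p b) x ∧ ¬ Reg (O a p b) x)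
    (h1 : (O a p b).card = 2) (h2 : (O a p (!b)).card = 2) (h3 : (O (!a) p b).card = 2) (h4 : (O (!a) p (!b)).card = 2)
    (hv1 : (O a (!p) b1).card = 1) (hw1 : (O (!a) (!p) b1).card = 1)
    (hv6 : (O a (!p) (!b1)).card = 6) (hw6 : (O (!a) (!p) (!b1)).card = 6) : False := by
  obtain ⟨v', hv'⟩ := Finset.card_eq_one.1 hv1
  obtain ⟨w', hw'⟩ := Finset.card_eq_one.1 hw1
  obtain ⟨j, k, nj, nk, off, hall⟩ := hO.sideI rfl rfl h1 h2 hv' hw'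
  obtain ⟨j2, k2, nj2, nk2, off2, hall2⟩ := hO.sideI (a := !a) (a' := a) (by simp) rfl h3 h4 hw' hv'
  have f1 := hO.five rfl rfl hP hw1
  have f2 := hO.five (a := !a) (a' := a) (by simp) rfl hN hv1
  have g1 := f1.trans (fil_le (j := j) (s := w' j) (fun w hw hm => (hall w hw hm).1))
  have g2 := f2.trans (fil_le (j := j) (s := v' j) (fun w hw hm => by
    have := hall2 w hw hm
    by_cases e1 : j = j2
    · rw [e1]; exact this.1
    by_cases e2 : j = k2
    · rw [e2]; exact this.2
    · exact absurd (by rw [off2 j e1 e2]) nj))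
  have hz : ∀ x, cnt (O a (!p) (!b1)) x + cnt (O (!a) (!p) b1) x = cnt (O a (!p) b1) x + cnt (O (!a) (!p) (!b1)) x := by
    intro x
    have := hO.eq a p b b1 x
    have := hO.eq a p b (!b1) x
    omega
  obtain ⟨B, hB, _⟩ := two_lit (fl_ne (v' j)).symm
  have hc := four (A := slV j (v' j) (O a (!p) (!b1))) (B := slV j (v' j) (O (!a) (!p) b1)) (C := slV j (fl (v' j)) (O a (!p) b1))
    (D := slV j (fl (v' j)) (O (!a) (!p) (!b1))) (E := slV j (fl (v' j)) (O a (!p) (!b1))) (F := slV j (fl (v' j)) (O (!a) (!p) b1))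
    (G := slV j (v' j) (O a (!p) b1)) (H := slV j (v' j) (O (!a) (!p) (!b1))) (by
      intro y
      have z1 := hz (ins j B y)
      have z2 := hz (ins j (flipB B (v' j).1) y)
      have c1 := cnt_flip j (O a (!p) (!b1)) hB y
      have c2 := cnt_flip j (O (!a) (!p) b1) hB y
      have c3 := cnt_flip j (O a (!p) b1) hB y
      have c4 := cnt_flip j (O (!a) (!p) (!b1)) hB y
      omega)
  have s1 := card_sl2 j (O a (!p) (!b1)) (fl_ne (v' j)).symm
  have s2 := card_sl2 j (O (!a) (!p) b1) (fl_ne (v' j)).symm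
  have s3 := card_sl2 j (O a (!p) b1) (fl_ne (v' j)).symm
  have s4 := card_sl2 j (O (!a) (!p) (!b1)) (a := v' j) (b := w' j) (ne_of_fst nj)
  omega

theorem main (hO : Oct O) (p : Bool) (hP : ∀ a b, ∃ x, Reg (O a p b) x ∧ ¬ Reg (O (!a) p b) x)
    (hcol : ∀ j, ∃ k1 k2, ∀ a p b, ∀ v ∈ O a p b, (v j).1 = k1 ∨ (v j).1 = k2)
    (lo : ∀ a b, 2 ≤ (O a p b).card) (hi : ∀ a b, (O a p b).card ≤ 3)
    (h2 : ∃ a b, (O a p b).card = 2)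
    (tot : ∀ a b b', (O a p b).card + (O a p (!b)).card + (O (!a) p b).card + (O (!a) p (!b)).card +
      (O a (!p) b').card + (O a (!p) (!b')).card + (O (!a) (!p) b').card + (O (!a) (!p) (!b')).card ≤ 22) : False := by
  obtain ⟨a, b, hab⟩ := h2
  by_cases hr : ∀ b', ∀ w ∈ O (!a) (!p) b', Pm (O a p b) w
  · exact hO.noRest a p b (hP a b) hab (hi _ _) (hi _ _) hcol hr
  · push Not at hr
    obtain ⟨b', w, hw, hr⟩ := hr
    have hN := hP (!a) b
    rw [Bool.not_not] at hN
    obtain ⟨⟨⟨k1, k2⟩, k3, k4⟩, ⟨⟨k5, k6⟩, k7, k8⟩ | ⟨⟨k5, k6⟩, k7, k8⟩⟩ := hO.arith rfl rfl (hP a b) hN (lo _ _) (lo _ _) (lo _ _) (lo _ _) hw hr (tot a b b')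
    · exact hO.caseII a p b (!b') k1 k2 k6 k8 hcol
    · exact hO.caseI a p b (!b') (hP a b) hN k1 k2 k3 k4 k6 k8 (by rw [Bool.not_not]; exact k5) (by rw [Bool.not_not]; exact k7)
end
end Oct
end PB
namespace PB
open Finset Classical
universe u
variable {K : Type u} {d n : ℕ} [Fintype K]

def MM (K : Type u) (m : ℕ) : Prop := ∀ X Y : Finset (Word K m), Good X → Good Y → Disjoint X Y →
  (∀ x, cnt X x = cnt Y x) → X.card ≤ 11 → X = ∅

theorem lem56 {E F G : Finset (Word K d)} (gE : Good E) (dEF : Disjoint E F) (dEG : Disjoint E G)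
    (h : ∀ x, cnt E x = cnt F x + cnt G x) (hF : F.Nonempty) (hM : ∀ m < d, MM K m) (hE : E.card ≤ 11) : 6 ≤ E.card := by
  have covF : ∀ u ∈ F, ∀ p, mem u p → Reg E p := by
    intro u hu p hp
    have := h p; have := mem_cnt hu hp; have := cnt_nonneg G p
    exact cnt_pos.1 (by omega)
  have covG : ∀ u ∈ G, ∀ p, mem u p → Reg E p := by
    intro u hu p hp
    have := h p; have := mem_cnt hu hp; have := cnt_nonneg F p
    exact cnt_pos.1 (by omega)
  obtain ⟨f, hf⟩ := hF
  have h5 := cover5 E f gE (Finset.disjoint_right.1 dEF hf) (covF f hf)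
  by_contra hc
  have he : E.card = 5 := by omega
  have all : ∀ u, u ∉ E → (∀ p, mem u p → Reg E p) → ∀ e ∈ E, Meets e u := by
    intro u hu hcov e hee
    have c1 := cover5 (ft E u) u (gE.mono (ft_sub _ _)) (fun h => hu (ft_sub _ _ h)) (fun p hp => (Reg_ft hp).2 (hcov p hp))
    have : ft E u = E := Finset.eq_of_subset_of_card_le (ft_sub _ _) (by omega)
    rw [← this] at hee; exact (mem_ft.1 hee).2
  obtain ⟨e1, m1, e2, m2, hne⟩ := Finset.one_lt_card.1 (show 1 < E.card by omega)
  obtain ⟨j, hj⟩ := Oct.dich gE m1 m2 hne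
  rcases d with _ | m
  · exact j.elim0
  have no : ∀ u, u ∉ E → (∀ p, mem u p → Reg E p) → u j ≠ e1 j ∧ u j ≠ fl (e1 j) := by
    intro u hu hcov
    constructor
    · intro e; apply (all u hu hcov e2 m2).ne j; rw [hj, fl_fl, e]
    · exact (all u hu hcov e1 m1).ne j
  have nF : ∀ u ∈ F, u j ≠ e1 j ∧ u j ≠ fl (e1 j) := fun u hu => no u (Finset.disjoint_right.1 dEF hu) (covF u hu)
  have nG : ∀ u ∈ G, u j ≠ e1 j ∧ u j ≠ fl (e1 j) := fun u hu => no u (Finset.disjoint_right.1 dEG hu) (covG u hu)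
  have := hM m (by omega) (slV j (e1 j) E) (slV j (fl (e1 j)) E) (gE.sl _ _) (gE.sl _ _)
    (Finset.disjoint_left.2 fun v h1 h2 => gE.sl_tw h1 h2) (by
      intro y
      obtain ⟨B, hB, _⟩ := two_lit (fl_ne (e1 j)).symm
      have c1 := cnt_flip j E hB y
      have c2 := cnt_flip j F hB y
      have c3 := cnt_flip j G hB y
      rw [sl_empty (fun u hu => (nF u hu).1), sl_empty (fun u hu => (nF u hu).2)] at c2
      rw [sl_empty (fun u hu => (nG u hu).1), sl_empty (fun u hu => (nG u hu).2)] at c3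
      have := h (ins j B y); have := h (ins j (flipB B (e1 j).1) y)
      omega) (by have := card_sl2 j E (fl_ne (e1 j)).symm; omega)
  have r := rem_mem_slV (i := j) m1
  rw [this] at r; simp at r

theorem pairHalf {A A' C C' : Finset (Word K d)} (gC : Good C) (gC' : Good C')
    (dCC : Disjoint C C') (dAC : Disjoint A C) (dAC' : Disjoint A' C') (gA : Good A) (gA' : Good A')
    (heq : ∀ x, cnt A x + cnt C' x = cnt A' x + cnt C x) (hne : ∃ x, cnt A x ≠ cnt C x)
    (hno : ∀ x, Reg A x → Reg C x) (hM : ∀ m ≤ d, MM K m) (s1 : C.card ≤ 11) (s2 : C'.card ≤ 11) :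
    12 ≤ A.card + A'.card + C.card + C'.card := by
  have hle : ∀ x, cnt A x ≤ cnt C x := by
    intro x
    rw [cnt_good gA, cnt_good gC]
    by_cases h : Reg A x
    · simp [h, hno x h]
    · simp only [h, if_false]; split_ifs <;> simp
  have hle' : ∀ x, cnt A' x ≤ cnt C' x := by intro x; have := hle x; have := heq x; omega
  have v := card_eq2 heq
  have cov : ∀ {A C : Finset (Word K d)}, Good C → Disjoint A C → (∀ x, cnt A x ≤ cnt C x) → A.Nonempty → 5 ≤ C.card := by
    rintro A C gC hd hle ⟨u, hu⟩
    exact cover5 C u gC (Finset.disjoint_left.1 hd hu) (fun p hp => cnt_pos.1 ((mem_cnt hu hp).trans_le (hle p)))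
  by_cases hA : A = ∅
  · by_cases hA' : A' = ∅
    · exfalso
      subst hA hA'
      obtain ⟨x, hx⟩ := hne
      have := hM d le_rfl C C' gC gC' dCC (fun x => by have := heq x; simp only [cnt_empty] at this; omega) s1
      rw [this] at hx; exact hx rfl
    · subst hA
      have := lem56 (E := C') (F := A') (G := C) gC' dAC'.symm dCC.symm (fun x => by have := heq x; rw [cnt_empty] at this; omega)
        (Finset.nonempty_iff_ne_empty.2 hA') (fun m hm => hM m hm.le) s2
      simp at v ⊢; omega
  · by_cases hA' : A' = ∅
    · subst hA'
      have := lem56 (E := C) (F := A) (G := C') gC dAC.symm dCC (fun x => by have := heq x; rw [cnt_empty] at this; omega)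
        (Finset.nonempty_iff_ne_empty.2 hA) (fun m hm => hM m hm.le) s1
      simp at v ⊢; omega
    · have n1 := Finset.nonempty_iff_ne_empty.2 hA
      have n2 := Finset.nonempty_iff_ne_empty.2 hA'
      have := cov gC dAC hle n1
      have := cov gC' dAC' hle' n2
      have := Finset.card_pos.2 n1
      have := Finset.card_pos.2 n2
      omega

def Dd (n n' : ℕ) : Prop := (n = 1 ∧ 5 ≤ n') ∨ (5 ≤ n ∧ n' = 1) ∨ (2 ≤ n ∧ 2 ≤ n')
theorem Dd_of {A A' : Finset (Word K d)} (gA : Good A) (gA' : Good A') (dis : Disjoint A A') {w p}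
    (hw : mem w p) (hp : Reg A p) (h : ∀ q, mem w q → (Reg A q ↔ Reg A' q)) : (5 ≤ A'.card ∨ 2 ≤ A.card) ∧ (5 ≤ A.card ∨ 2 ≤ A'.card) ∧ 1 ≤ A.card ∧ 1 ≤ A'.card := by
  have := lemD gA gA' dis h ⟨p, hw, hp⟩
  have := ft_card A w
  have := ft_card A' w
  omega

/-- everything about one pair of letters in one column -/
structure PairOut (A A' C C' : Finset (Word K d)) : Prop where
  P : ∃ x, Reg A x ∧ ¬ Reg C x
  N : ∃ x, Reg C x ∧ ¬ Reg A x
  D1 : (5 ≤ A'.card ∨ 2 ≤ A.card) ∧ (5 ≤ A.card ∨ 2 ≤ A'.card) ∧ 1 ≤ A.card ∧ 1 ≤ A'.card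
  D2 : (5 ≤ C'.card ∨ 2 ≤ C.card) ∧ (5 ≤ C.card ∨ 2 ≤ C'.card) ∧ 1 ≤ C.card ∧ 1 ≤ C'.card

theorem pairT {A A' C C' : Finset (Word K d)} (gA : Good A) (gA' : Good A') (gC : Good C) (gC' : Good C')
    (dAA : Disjoint A A') (dCC : Disjoint C C') (dAC : Disjoint A C) (dAC' : Disjoint A' C')
    (heq : ∀ x, cnt A x + cnt C' x = cnt A' x + cnt C x) (hne : ∃ x, cnt A x ≠ cnt C x)
    (hP : ∀ p, Reg A p → ¬ Reg C p → ∃ w, mem w p ∧ ∀ q, mem w q → (Reg A q ↔ Reg A' q))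
    (hN : ∀ p, Reg C p → ¬ Reg A p → ∃ w, mem w p ∧ ∀ q, mem w q → (Reg C q ↔ Reg C' q))
    (hM : ∀ m ≤ d, MM K m) (s1 : A.card ≤ 11) (s2 : A'.card ≤ 11) (s3 : C.card ≤ 11) (s4 : C'.card ≤ 11) :
    12 ≤ A.card + A'.card + C.card + C'.card ∨ PairOut A A' C C' := by
  by_cases h1 : ∀ x, Reg A x → Reg C x
  · left; exact pairHalf gC gC' dCC dAC dAC' gA gA' heq hne h1 hM s3 s4
  by_cases h2 : ∀ x, Reg C x → Reg A x
  · left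
    have := pairHalf gA gA' dAA dAC.symm dAC'.symm gC gC' (fun x => by have := heq x; omega) (by obtain ⟨x, hx⟩ := hne; exact ⟨x, hx.symm⟩) h2 hM s1 s2
    omega
  right
  push Not at h1 h2
  obtain ⟨x, x1, x2⟩ := h1
  obtain ⟨y, y1, y2⟩ := h2
  obtain ⟨w, w1, w2⟩ := hP x x1 x2
  obtain ⟨v, v1, v2⟩ := hN y y1 y2
  exact ⟨⟨x, x1, x2⟩, ⟨y, y1, y2⟩, Dd_of gA gA' dAA w1 x1 w2, Dd_of gC gC' dCC v1 y1 v2⟩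

/-! the column analysis -/
theorem otherW {V W : Finset (Word K (n+1))} (heq : ∀ x, cnt V x = cnt W x) {i : Fin (n+1)} {s p}
    (h1 : Reg (slV i s V) p) (h2 : ¬ Reg (slV i s W) p) : ∃ w ∈ W, (w i).1 ≠ s.1 ∧ mem (rem i w) p := by
  obtain ⟨B, hB, _⟩ := two_lit (fl_ne s).symm
  have : Reg V (ins i B p) := Reg_ins.2 ⟨s, hB, h1⟩
  rw [reg_of_cnt (heq _)] at this
  obtain ⟨w, hw, hm⟩ := this
  rw [mem_iff_rem] at hm
  refine ⟨w, hw, ?_, hm.2⟩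
  intro e
  have e' := lit_eq hm.1 hB e
  exact h2 ⟨_, e' ▸ rem_mem_slV hw, hm.2⟩
theorem onslice {V W : Finset (Word K (n+1))} (gW : Good W) (heq : ∀ x, cnt V x = cnt W x) {i : Fin (n+1)} {s w}
    (hw : w ∈ W) (hs : (w i).1 ≠ s.1) {q} (hq : mem (rem i w) q) : Reg (slV i s V) q ↔ Reg (slV i (fl s) V) q := by
  obtain ⟨B, hB1, hB2⟩ := two_lit (a := s) (b := w i) (ne_fl_of_fst hs)
  apply flip_reg hB1
  rw [heq, heq, cnt_good gW, cnt_good gW, if_pos, if_pos]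
  · exact ⟨w, hw, mem_iff_rem.2 ⟨(lit_flip_ne hs).2 hB2, hq⟩⟩
  · exact ⟨w, hw, mem_iff_rem.2 ⟨hB2, hq⟩⟩
theorem flipVW {V W : Finset (Word K (n+1))} (heq : ∀ x, cnt V x = cnt W x) (i : Fin (n+1)) (s x) :
    cnt (slV i s V) x + cnt (slV i (fl s) W) x = cnt (slV i (fl s) V) x + cnt (slV i s W) x := by
  obtain ⟨B, hB, _⟩ := two_lit (fl_ne s).symm
  have c1 := cnt_flip i V hB x
  have c2 := cnt_flip i W hB x
  rw [heq, heq] at c1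
  omega

structure Ctx (V W : Finset (Word K (n+1))) : Prop where
  gV : Good V
  gW : Good W
  dis : Disjoint V W
  eq : ∀ x, cnt V x = cnt W x
  c : V.card ≤ 11
  hM : ∀ m ≤ n, MM K m

namespace Ctx
variable {V W : Finset (Word K (n+1))}
theorem cW (h : Ctx V W) : W.card ≤ 11 := by rw [← card_eq1 h.eq]; exact h.c
theorem slc (i : Fin (n+1)) (s) : (slV i s V).card ≤ V.card := by
  have := card_sl2 i V (fl_ne s).symm; omega
theorem hne (h : Ctx V W) {i : Fin (n+1)} {s : K × Bool} (hu : ∃ v ∈ V ∪ W, (v i).1 = s.1) : ∃ x, cnt (slV i s V) x ≠ cnt (slV i s W) x := by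
  by_contra hc
  push Not at hc
  have hc' : ∀ x, cnt (slV i (fl s) V) x = cnt (slV i (fl s) W) x := by
    intro x; have := flipVW h.eq i s x; have := hc x; omega
  have key : ∀ t, (∀ x, cnt (slV i t V) x = cnt (slV i t W) x) → slV i t V = ∅ ∧ slV i t W = ∅ := by
    intro t ht
    exact ⟨h.hM n le_rfl _ _ (h.gV.sl i t) (h.gW.sl i t) (sl_disj h.dis i t) ht ((slc i t).trans h.c),
      h.hM n le_rfl _ _ (h.gW.sl i t) (h.gV.sl i t) (sl_disj h.dis i t).symm (fun x => (ht x).symm) ((slc i t).trans h.cW)⟩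
  have k1 := key s hc
  have k2 := key (fl s) hc'
  obtain ⟨v, hv, e⟩ := hu
  rcases eq_or_fl e with e | e <;> rcases mem_union.1 hv with hv | hv <;> have := rem_mem_slV (i := i) hv <;> rw [e] at this
  · rw [k1.1] at this; simp at this
  · rw [k1.2] at this; simp at this
  · rw [k2.1] at this; simp at this
  · rw [k2.2] at this; simp at this
theorem other (h : Ctx V W) {i : Fin (n+1)} {s : K × Bool} (hu : ∃ v ∈ V ∪ W, (v i).1 = s.1) : ∃ v ∈ V ∪ W, (v i).1 ≠ s.1 := by
  obtain ⟨x, hx⟩ := h.hne hu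
  rw [cnt_good (h.gV.sl _ _), cnt_good (h.gW.sl _ _)] at hx
  by_cases h1 : Reg (slV i s V) x
  · by_cases h2 : Reg (slV i s W) x
    · simp [h1, h2] at hx
    · obtain ⟨w, hw, e, _⟩ := otherW h.eq h1 h2
      exact ⟨w, mem_union_right _ hw, e⟩
  · by_cases h2 : Reg (slV i s W) x
    · obtain ⟨w, hw, e, _⟩ := otherW (fun x => (h.eq x).symm) h2 h1
      exact ⟨w, mem_union_left _ hw, e⟩
    · simp [h1, h2] at hx
theorem pair (h : Ctx V W) {i : Fin (n+1)} {s : K × Bool} (hu : ∃ v ∈ V ∪ W, (v i).1 = s.1) :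
    12 ≤ (slV i s V).card + (slV i (fl s) V).card + (slV i s W).card + (slV i (fl s) W).card ∨
      PairOut (slV i s V) (slV i (fl s) V) (slV i s W) (slV i (fl s) W) := by
  refine pairT (h.gV.sl _ _) (h.gV.sl _ _) (h.gW.sl _ _) (h.gW.sl _ _) (Finset.disjoint_left.2 fun v h1 h2 => h.gV.sl_tw h1 h2)
    (Finset.disjoint_left.2 fun v h1 h2 => h.gW.sl_tw h1 h2) (sl_disj h.dis _ _) (sl_disj h.dis _ _) (flipVW h.eq i s) (h.hne hu) ?_ ?_ h.hM
    ((slc _ _).trans h.c) ((slc _ _).trans h.c) ((slc _ _).trans h.cW) ((slc _ _).trans h.cW)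
  · intro p h1 h2
    obtain ⟨w, hw, e, hm⟩ := otherW h.eq h1 h2
    exact ⟨rem i w, hm, fun q hq => onslice h.gW h.eq hw e hq⟩
  · intro p h1 h2
    obtain ⟨w, hw, e, hm⟩ := otherW (fun x => (h.eq x).symm) h1 h2
    exact ⟨rem i w, hm, fun q hq => onslice h.gV (fun x => (h.eq x).symm) hw e hq⟩

noncomputable def T (V W : Finset (Word K (n+1))) (i : Fin (n+1)) (k : K) : ℕ :=
  (slV i (k, true) V).card + (slV i (k, false) V).card + (slV i (k, true) W).card + (slV i (k, false) W).card
theorem sumT (V W : Finset (Word K (n+1))) (i : Fin (n+1)) : ∑ k, T V W i k = V.card + W.card := by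
  rw [card_sl i V, card_sl i W, Fintype.sum_prod_type, Fintype.sum_prod_type, ← Finset.sum_add_distrib]
  refine Finset.sum_congr rfl (fun k _ => ?_)
  rw [Fintype.sum_bool, Fintype.sum_bool]; unfold T; omega
theorem T8 (h : Ctx V W) {i : Fin (n+1)} {k} (hu : ∃ v ∈ V ∪ W, (v i).1 = k) : 8 ≤ T V W i k := by
  have := h.pair (i := i) (s := (k, true)) hu
  unfold T
  have e : fl (k, true) = (k, false) := rfl
  rw [e] at this
  rcases this with h1 | h1
  · omega
  · have := h1.D1; have := h1.D2; omega
theorem two (h : Ctx V W) (hV : V.Nonempty) (i : Fin (n+1)) : ∃ k1 k2, k1 ≠ k2 ∧ (∃ v ∈ V ∪ W, (v i).1 = k1) ∧ (∃ v ∈ V ∪ W, (v i).1 = k2) ∧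
    (∀ v ∈ V ∪ W, (v i).1 = k1 ∨ (v i).1 = k2) ∧ T V W i k1 + T V W i k2 ≤ 22 := by
  obtain ⟨v0, hv0⟩ := hV
  have u1 : ∃ v ∈ V ∪ W, (v i).1 = (v0 i).1 := ⟨v0, mem_union_left _ hv0, rfl⟩
  obtain ⟨v1, hv1, e1⟩ := h.other (i := i) (s := v0 i) u1
  have u2 : ∃ v ∈ V ∪ W, (v i).1 = (v1 i).1 := ⟨v1, hv1, rfl⟩
  have hs := sumT V W i
  have := h.c; have := h.cW
  refine ⟨_, _, e1.symm, u1, u2, ?_, ?_⟩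
  · intro v hv
    by_contra hc
    push Not at hc
    have u3 : ∃ v' ∈ V ∪ W, (v' i).1 = (v i).1 := ⟨v, hv, rfl⟩
    have t1 := h.T8 u1
    have t2 := h.T8 u2
    have t3 := h.T8 u3
    have : ∑ k ∈ {(v0 i).1, (v1 i).1, (v i).1}, T V W i k ≤ ∑ k, T V W i k := Finset.sum_le_sum_of_subset (subset_univ _)
    rw [Finset.sum_insert (by simp [e1.symm, hc.1.symm]), Finset.sum_pair hc.2.symm] at this
    omega
  · have : ∑ k ∈ {(v0 i).1, (v1 i).1}, T V W i k ≤ ∑ k, T V W i k := Finset.sum_le_sum_of_subset (subset_univ _)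
    rw [Finset.sum_pair e1.symm] at this
    omega
end Ctx

theorem mkOct {U : Bool → Finset (Word K (n+1))} {kk : Bool → K} {i : Fin (n+1)} (g : ∀ a, Good (U a)) (dis : ∀ a, Disjoint (U a) (U (!a)))
    (eq : ∀ a x, cnt (U a) x = cnt (U (!a)) x) (hk : ∀ p, kk p ≠ kk (!p)) (ho : ∀ a p, ∀ v ∈ U a, (v i).1 = kk p ∨ (v i).1 = kk (!p)) :
    Oct (fun a p b => slV i (kk p, b) (U a)) := by
  constructor
  · intro a p b; exact (g a).sl _ _
  · intro a p b; exact Finset.disjoint_left.2 fun v h1 h2 => (g a).sl_tw h1 h2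
  · intro a p b; exact sl_disj (dis a) _ _
  · rintro a p b b' x ⟨u, hu, hux⟩ ⟨v, hv, hvx⟩
    exact (g a).sl_sep (ne_fl_of_fst (hk p).symm) (ne_of_fst (hk p)) hu hv hux hvx
  · intro a p b b' x
    obtain ⟨B, hB1, hB2⟩ := two_lit (a := (kk p, b)) (b := (kk (!p), b')) (ne_fl_of_fst (hk p).symm)
    have hl : ∀ a, ∀ v ∈ U a, lit B (v i) → v i = (kk p, b) ∨ v i = (kk (!p), b') := by
      intro a v hv hl
      rcases ho a p v hv with e | e
      · left; exact lit_eq hl hB1 e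
      · right; exact lit_eq hl hB2 e
    have := eq a (ins i B x)
    rw [cnt_two i _ hB1 hB2 (ne_of_fst (hk p)) (hl _), cnt_two i _ hB1 hB2 (ne_of_fst (hk p)) (hl _)] at this
    exact this

theorem Ctx.contra {V W : Finset (Word K (n+1))} (h : Ctx V W) (hV : V.Nonempty) : False := by
  obtain ⟨k1, k2, hne, u1, u2, ho, htot⟩ := h.two hV 0
  let U : Bool → Finset (Word K (n+1)) := fun a => cond a V W
  let kk : Bool → K := fun p => cond p k1 k2
  let i : Fin (n+1) := 0
  have hUsub : ∀ a, U a ⊆ V ∪ W := by intro a; cases a; exacts [subset_union_right, subset_union_left]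
  have hO : Oct (fun a p b => slV i (kk p, b) (U a)) := by
    apply mkOct
    · intro a; cases a; exacts [h.gW, h.gV]
    · intro a; cases a; exacts [h.dis.symm, h.dis]
    · intro a x; cases a; exacts [(h.eq x).symm, h.eq x]
    · intro p; cases p; exacts [hne.symm, hne]
    · intro a p v hv; have := ho v (hUsub a hv); cases p
      · exact this.symm
      · exact this
  obtain ⟨p, hp, hu⟩ : ∃ p, Ctx.T V W i (kk p) ≤ 11 ∧ ∃ v ∈ V ∪ W, (v i).1 = kk p := by
    by_cases h1 : Ctx.T V W i k1 ≤ 11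
    · exact ⟨true, h1, u1⟩
    · refine ⟨false, ?_, u2⟩
      show Ctx.T V W i k2 ≤ 11
      have : Ctx.T V W i k1 + Ctx.T V W i k2 ≤ 22 := htot
      omega
  unfold Ctx.T at hp
  have pt : PairOut (slV i (kk p, true) V) (slV i (kk p, false) V) (slV i (kk p, true) W) (slV i (kk p, false) W) := by
    rcases h.pair (i := i) (s := (kk p, true)) hu with h1 | h1
    · have h2 : 12 ≤ (slV i (kk p, true) V).card + (slV i (kk p, false) V).card + (slV i (kk p, true) W).card + (slV i (kk p, false) W).card := h1
      omega
    · exact h1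
  have pf : PairOut (slV i (kk p, false) V) (slV i (kk p, true) V) (slV i (kk p, false) W) (slV i (kk p, true) W) := by
    rcases h.pair (i := i) (s := (kk p, false)) hu with h1 | h1
    · have h2 : 12 ≤ (slV i (kk p, false) V).card + (slV i (kk p, true) V).card + (slV i (kk p, false) W).card + (slV i (kk p, true) W).card := h1
      omega
    · exact h1
  have vv : (slV i (kk p, true) V).card + (slV i (kk p, false) W).card = (slV i (kk p, false) V).card + (slV i (kk p, true) W).card :=
    card_eq2 (flipVW h.eq i (kk p, true))
  have D1 := pt.D1
  have D2 := pt.D2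
  have lo : ∀ a b, 2 ≤ (slV i (kk p, b) (U a)).card := by
    intro a b; cases a <;> cases b <;> simp only [U, cond_true, cond_false] <;> omega
  have hi : ∀ a b, (slV i (kk p, b) (U a)).card ≤ 3 := by
    intro a b; cases a <;> cases b <;> simp only [U, cond_true, cond_false] <;> omega
  have h2 : ∃ a b, (slV i (kk p, b) (U a)).card = 2 := by
    by_contra hc
    push Not at hc
    have l1 := lo true true; have l2 := lo true false; have l3 := lo false true; have l4 := lo false false
    have c1 := hc true true; have c2 := hc true false; have c3 := hc false true; have c4 := hc false false
    simp only [U, cond_true, cond_false] at l1 l2 l3 l4 c1 c2 c3 c4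
    omega
  have hP : ∀ a b, ∃ x, Reg (slV i (kk p, b) (U a)) x ∧ ¬ Reg (slV i (kk p, b) (U (!a))) x := by
    intro a b; cases a <;> cases b
    exacts [pf.N, pt.N, pf.P, pt.P]
  rcases n with _ | m
  · have l1 := lo true true
    have : (slV i (kk p, true) (U true)).card ≤ 1 := Finset.card_le_one.2 (fun a _ b _ => Subsingleton.elim a b)
    omega
  refine Oct.main hO p hP ?_ lo hi h2 ?_
  · intro j
    obtain ⟨q1, q2, _, _, _, hq, _⟩ := h.two hV (i.succAbove j)
    refine ⟨q1, q2, ?_⟩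
    intro a p b v hv
    have := hq _ (hUsub a (mem_slV.1 hv))
    rwa [ins_succ] at this
  · have htot' : Ctx.T V W i (kk p) + Ctx.T V W i (kk (!p)) ≤ 22 := by
      cases p
      · have : Ctx.T V W i k1 + Ctx.T V W i k2 ≤ 22 := htot
        show Ctx.T V W i k2 + Ctx.T V W i k1 ≤ 22
        omega
      · exact htot
    unfold Ctx.T at htot'
    intro a b b'
    cases a <;> cases b <;> cases b' <;> simp only [U, cond_true, cond_false, Bool.not_true, Bool.not_false] <;> omega

theorem allMM (m : ℕ) : MM K m := by
  induction m using Nat.strong_induction_on with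
  | _ m ih =>
    intro X Y gX gY hd he hc
    by_contra hne
    have hX := Finset.nonempty_iff_ne_empty.2 hne
    rcases m with _ | n
    · obtain ⟨u, hu⟩ := hX
      obtain ⟨x, hx⟩ := exists_mem u
      obtain ⟨v, hv, _⟩ := (reg_of_cnt (he x)).1 ⟨u, hu, hx⟩
      rw [Subsingleton.elim v u] at hv
      exact Finset.disjoint_left.1 hd hu hv
    · exact Ctx.contra ⟨gX, gY, hd, he, hc, fun m hm => ih m (by omega)⟩ hX

theorem ge12 {X Y : Finset (Word K d)} (gX : Good X) (gY : Good Y) (hd : Disjoint X Y) (he : ∀ x, cnt X x = cnt Y x)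
    (hX : X.Nonempty) : 12 ≤ X.card := by
  by_contra hc
  exact hX.ne_empty (allMM d X Y gX gY hd he (by omega))
end PB
namespace PB
open Finset Classical
universe u
variable {K : Type u} {d n : ℕ} [Fintype K]

theorem cnt_one (i : Fin (n+1)) (V : Finset (Word K (n+1))) {B : K → Bool} {a : K × Bool} (ha : lit B a)
    (hV : ∀ v ∈ V, (v i).1 = a.1) (y : Pt K n) : cnt V (ins i B y) = cnt (slV i a V) y := by
  rw [cnt_ins, Finset.sum_eq_single a]
  · simp [ha]
  · intro s _ hs
    split_ifs with h
    · rw [cnt_zero]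
      rintro ⟨u, hu, _⟩
      have h1 := hV _ (mem_slV.1 hu)
      rw [ins_same] at h1
      exact hs (lit_eq h ha h1)
    · rfl
  · simp

theorem final {V W : Finset (Word K (n+1))} (gV : Good V) (gW : Good W) (dis : Disjoint V W) (eq : ∀ x, cnt V x = cnt W x)
    (i : Fin (n+1)) (L : K × Bool) (hall : ∀ v ∈ V, (v i).1 = L.1) (h1 : ∃ v ∈ V, v i = L) (h2 : ∃ v ∈ V, v i = fl L) : 24 ≤ V.card := by
  by_cases hW : ∀ w ∈ W, (w i).1 = L.1
  · have key : ∀ s : K × Bool, s.1 = L.1 → (∃ v ∈ V, v i = s) → 12 ≤ (slV i s V).card := by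
      rintro s hs ⟨v, hv, e⟩
      obtain ⟨B, hB, _⟩ := two_lit (fl_ne s).symm
      refine ge12 (gV.sl i s) (gW.sl i s) (sl_disj dis i s) ?_ ⟨rem i v, e ▸ rem_mem_slV hv⟩
      intro y
      rw [← cnt_one i V hB (fun v hv => (hall v hv).trans hs.symm), ← cnt_one i W hB (fun v hv => (hW v hv).trans hs.symm), eq]
    have := key L rfl h1
    have := key (fl L) rfl h2
    have := card_sl2 i V (fl_ne L).symm
    omega
  · push Not at hW
    obtain ⟨w, hw, ht⟩ := hW
    have e1 : slV i (w i) V = ∅ := sl_empty (fun v hv e => ht (by rw [← e]; exact hall v hv))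
    have e2 : slV i (fl (w i)) V = ∅ := sl_empty (fun v hv e => ht (by rw [← hall v hv, e]; rfl))
    have he : ∀ x, cnt (slV i (w i) W) x = cnt (slV i (fl (w i)) W) x := by
      intro x
      have := flipVW eq i (w i) x
      rw [e1, e2, cnt_empty] at this
      omega
    have d1 : Disjoint (slV i (w i) W) (slV i (fl (w i)) W) := Finset.disjoint_left.2 fun v h1 h2 => gW.sl_tw h1 h2
    have := ge12 (gW.sl i (w i)) (gW.sl i _) d1 he ⟨_, rem_mem_slV hw⟩
    have := card_eq1 he
    have := card_sl2 i W (fl_ne (w i)).symm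
    have := card_eq1 eq
    omega

section enc
variable {S : Type u} [Fintype S]

noncomputable def ph (c : S → S) (s : S) : S × Bool :=
  if Fintype.equivFin S s < Fintype.equivFin S (c s) then (s, true) else (c s, false)

theorem ph_c {c : S → S} (hinv : ∀ s, c (c s) = s) (hnfix : ∀ s, c s ≠ s) (s : S) : ph c (c s) = fl (ph c s) := by
  have hne : Fintype.equivFin S s ≠ Fintype.equivFin S (c s) := fun e => hnfix s ((Fintype.equivFin S).injective e).symm
  unfold ph fl
  rw [hinv]
  rcases lt_or_gt_of_ne hne with h | h
  · rw [if_neg (not_lt.2 h.le), if_pos h]; rfl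
  · rw [if_pos h, if_neg (not_lt.2 h.le)]; rfl
theorem ph_inj {c : S → S} (hinv : ∀ s, c (c s) = s) : Function.Injective (ph c) := by
  intro s t h
  unfold ph at h
  split_ifs at h with h1 h2 h2
  · exact congrArg Prod.fst h
  · exact absurd (congrArg Prod.snd h) (by simp)
  · exact absurd (congrArg Prod.snd h) (by simp)
  · have := congrArg c (congrArg Prod.fst h)
    simpa [hinv] using this

theorem enc {c : S → S} (hinv : ∀ s, c (c s) = s) (hnfix : ∀ s, c s ≠ s)
    (V W : Finset (Fin (n+1) → S))
    (hVcode : PolyboxCode c V) (hWcode : PolyboxCode c W)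
    (hVtp : TwinPairFree c V) (hWtp : TwinPairFree c W)
    (hdisj : Disjoint V W) (hequiv : EquivalentCodes c V W)
    (i : Fin (n+1)) (l : S)
    (hall : ∀ v ∈ V, v i = l ∨ v i = c l)
    (hl : ∃ v ∈ V, v i = l) (hl' : ∃ v ∈ V, v i = c l) :
    24 ≤ V.card := by
  let f : (Fin (n+1) → S) → Word S (n+1) := fun v j => ph c (v j)
  have fi : Function.Injective f := by
    intro u v h; funext j; exact ph_inj hinv (congrFun h j)
  have good : ∀ U : Finset (Fin (n+1) → S), PolyboxCode c U → TwinPairFree c U → Good (U.image f) := by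
    intro U h1 h2
    constructor
    · intro u hu v hv x hx hy
      obtain ⟨u, hu1, rfl⟩ := Finset.mem_image.1 hu
      obtain ⟨v, hv1, rfl⟩ := Finset.mem_image.1 hv
      by_contra hne
      obtain ⟨j, hj⟩ := h1 u hu1 v hv1 (fun e => hne (by rw [e]))
      have a := hx j
      have b := hy j
      simp only [f, hj, ph_c hinv hnfix] at a b
      exact lit_fl.1 b a
    · intro u hu v hv j hj e
      obtain ⟨u, hu1, rfl⟩ := Finset.mem_image.1 hu
      obtain ⟨v, hv1, rfl⟩ := Finset.mem_image.1 hv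
      refine h2 u hu1 v hv1 ⟨j, ?_, fun k hk => ph_inj hinv (hj k hk)⟩
      apply ph_inj hinv
      rw [ph_c hinv hnfix]; exact e
  have gV := good V hVcode hVtp
  have gW := good W hWcode hWtp
  let X : Pt S (n+1) → Fin (n+1) → Set S := fun y j => {s | lit (y j) (ph c s)}
  have hX : ∀ y j, X y j ∈ ESet c := by
    intro y j s
    show Xor' (lit (y j) (ph c s)) (lit (y j) (ph c (c s)))
    rw [ph_c hinv hnfix, lit_fl]
    by_cases h : lit (y j) (ph c s)
    · exact Or.inl ⟨h, not_not.2 h⟩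
    · exact Or.inr ⟨h, h⟩
  have hR : ∀ (U : Finset (Fin (n+1) → S)) y, Reg (U.image f) y ↔ X y ∈ CodeReal c U := by
    intro U y
    unfold CodeReal
    simp only [Set.mem_iUnion, exists_prop]
    constructor
    · rintro ⟨u, hu, hm⟩
      obtain ⟨u, hu1, rfl⟩ := Finset.mem_image.1 hu
      exact ⟨u, hu1, fun j => ⟨hX y j, hm j⟩⟩
    · rintro ⟨u, hu, hm⟩
      exact ⟨f u, Finset.mem_image_of_mem f hu, fun j => (hm j).2⟩
  have eq : ∀ x, cnt (V.image f) x = cnt (W.image f) x := by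
    intro x
    rw [cnt_good gV, cnt_good gW]
    have : Reg (V.image f) x ↔ Reg (W.image f) x := by
      rw [hR, hR]
      have e : CodeReal c V = CodeReal c W := hequiv
      rw [e]
    simp only [this]
  rw [← Finset.card_image_of_injective V fi]
  have hd : Disjoint (V.image f) (W.image f) := (Finset.disjoint_image fi).2 hdisj
  refine final gV gW hd eq i (ph c l) ?_ ?_ ?_
  · intro v hv
    obtain ⟨v, hv1, rfl⟩ := Finset.mem_image.1 hv
    show (ph c (v i)).1 = _
    rcases hall v hv1 with e | e
    · rw [e]
    · rw [e, ph_c hinv hnfix]; rfl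
  · obtain ⟨v, hv, e⟩ := hl
    exact ⟨f v, Finset.mem_image_of_mem f hv, congrArg (ph c) e⟩
  · obtain ⟨v, hv, e⟩ := hl'
    refine ⟨f v, Finset.mem_image_of_mem f hv, ?_⟩
    rw [← ph_c hinv hnfix]; exact congrArg (ph c) e
end enc
end PB

/-- If `V, W ⊆ S^d` are disjoint equivalent polybox codes without twin pairs and
`V = V^{i,l} ∪ V^{i,l'}` with both parts nonempty for some `i ∈ [d]`, `l ∈ S`,
then `|V| ≥ 24`. -/
theorem two_letter_column_card_ge_24 {S : Type*} [Fintype S] [DecidableEq S]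
    (c : S → S) (hinv : ∀ s, c (c s) = s) (hnfix : ∀ s, c s ≠ s)
    (d : ℕ) (V W : Finset (Fin d → S))
    (hVcode : PolyboxCode c V) (hWcode : PolyboxCode c W)
    (hVtp : TwinPairFree c V) (hWtp : TwinPairFree c W)
    (hdisj : Disjoint V W) (hequiv : EquivalentCodes c V W)
    (i : Fin d) (l : S)
    (hall : ∀ v ∈ V, v i = l ∨ v i = c l)
    (hl : ∃ v ∈ V, v i = l) (hl' : ∃ v ∈ V, v i = c l) :
    24 ≤ V.card := by
  rcases d with _ | n
  · exact i.elim0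
  · exact PB.enc hinv hnfix V W hVcode hWcode hVtp hWtp hdisj hequiv i l hall hl hl'
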